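/- arXiv:2504.02650 — 4 statements merged into one kernel-verified Lean document; each statement's English description precedes it below -/
import Mathlib

section
/- Every generalized twisted pre-rotation system on 7 elements contains T_6: there exist six distinct elements u_1,…,u_6 such that, for all 1 ≤ a < b < c < d ≤ 6, the disjoint edges {u_a,u_d} and {u_b,u_c} cross, and no other pair of disjoint edges among u_1,…,u_6 crosses. (In particular N_gt(T_6) ≤ 7.) -/
/-!
Common definitions for pre-rotation systems of simple drawings of complete graphs.

A cyclic permutation of a finite set `S` is modelled by an `Equiv.Perm` that fixes
everything outside `S` and has all of `S` in one cycle.  The ternary relation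
`CycOrd f S b c d` expresses that, traversing the cycle of `f` starting at `b`,
one meets `c` strictly before `d` (within one full period).  For sets with at least
three elements, a cyclic permutation is uniquely determined by this ternary relation,
so equality of induced subconfigurations is expressed via `CycOrd`.
-/

section Defs

variable {α : Type*}

/-- `f` is a cyclic permutation of the finite set `S`: it fixes every point outside `S`
and all elements of `S` lie on one common cycle of `f`. -/
def IsCyclicPermOn (f : Equiv.Perm α) (S : Finset α) : Prop :=
  (∀ a ∉ S, f a = a) ∧ ∀ a ∈ S, ∀ b ∈ S, ∃ k : ℕ, (⇑f)^[k] a = b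

/-- `b, c, d` appear in this cyclic order in the cyclic permutation `f` of the set `S`:
traversing the cycle starting at `b`, one meets `c` strictly before `d`
(both within one full period). -/
def CycOrd (f : Equiv.Perm α) (S : Finset α) (b c d : α) : Prop :=
  ∃ i j : ℕ, 0 < i ∧ i < j ∧ j < S.card ∧ (⇑f)^[i] b = c ∧ (⇑f)^[j] b = d

/-- A pre-rotation system on the finite vertex set `α`: every vertex `v` is assigned a
cyclic permutation of the remaining vertices. -/
structure PreRotSys (α : Type*) [Fintype α] [DecidableEq α] where
  rot : α → Equiv.Perm α
  cyc : ∀ v, IsCyclicPermOn (rot v) (Finset.univ.erase v)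

variable [Fintype α] [DecidableEq α]

/-- `b, c, d` appear in this cyclic (counterclockwise) order in the rotation of `v`. -/
def rotOrd (P : PreRotSys α) (v b c d : α) : Prop :=
  CycOrd (P.rot v) (Finset.univ.erase v) b c d

/-- `P'` is the reflection of `P`: every cyclic permutation is reversed. -/
def IsReflection (P P' : PreRotSys α) : Prop :=
  ∀ v, P'.rot v = (P.rot v)⁻¹

/-- `P` is Π4°-free: no induced subconfiguration on four elements is (up to relabelling,
possibly followed by reflection) the obstruction Π4° with
π_a=(b,c,d), π_b=(a,c,d), π_c=(a,b,d), π_d=(a,c,b). -/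
def Pi4Free (P : PreRotSys α) : Prop :=
  ∀ a b c d : α, a ≠ b → a ≠ c → a ≠ d → b ≠ c → b ≠ d → c ≠ d →
    ¬ (rotOrd P a b c d ∧ rotOrd P b a c d ∧ rotOrd P c a b d ∧ rotOrd P d a c b) ∧
    ¬ (rotOrd P a b d c ∧ rotOrd P b a d c ∧ rotOrd P c a d b ∧ rotOrd P d a b c)

/-- The disjoint edges `{p, r}` and `{q, s}` cross: the induced subconfiguration on
`{p, q, r, s}` is, possibly after reversing all four cyclic permutations, equal to
π_p=(q,r,s), π_q=(p,r,s), π_r=(p,q,s), π_s=(p,q,r). -/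
def Crosses (P : PreRotSys α) (p q r s : α) : Prop :=
  (p ≠ q ∧ p ≠ r ∧ p ≠ s ∧ q ≠ r ∧ q ≠ s ∧ r ≠ s) ∧
  ((rotOrd P p q r s ∧ rotOrd P q p r s ∧ rotOrd P r p q s ∧ rotOrd P s p q r) ∨
   (rotOrd P p q s r ∧ rotOrd P q p s r ∧ rotOrd P r p s q ∧ rotOrd P s p r q))

/-- Two pre-rotation systems are isomorphic: one is obtained from the other by
relabelling the elements, possibly followed by reflection. -/
def IsoPRS (P P' : PreRotSys α) : Prop :=
  ∃ e : Equiv.Perm α,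
    (∀ v, P'.rot (e v) = e * P.rot v * e⁻¹) ∨
    (∀ v, P'.rot (e v) = (e * P.rot v * e⁻¹)⁻¹)

/-- The induced subconfigurations `P|_I` and `P'|_I` are equal (expressed via the
ternary cyclic-order relations, which determine cyclic permutations of sets with
at least three elements). -/
def RestrictEq (P P' : PreRotSys α) (I : Finset α) : Prop :=
  ∀ v ∈ I, ∀ b ∈ I, ∀ c ∈ I, ∀ d ∈ I, (rotOrd P v b c d ↔ rotOrd P' v b c d)

/-- The induced subconfiguration `P'|_I` is the reflection of `P|_I` (expressed via
the ternary cyclic-order relations). -/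
def RestrictReflEq (P P' : PreRotSys α) (I : Finset α) : Prop :=
  ∀ v ∈ I, ∀ b ∈ I, ∀ c ∈ I, ∀ d ∈ I, (rotOrd P' v b c d ↔ rotOrd P v b d c)

/-- The `k` distinct elements `u 0, …, u (k-1)` form a perfect twisted configuration `T_k`:
for all `a < b < c < d`, the disjoint edges `{u a, u d}` and `{u b, u c}` cross, and no
other pair of disjoint edges among them crosses. -/
def TwistedTuple (P : PreRotSys α) {k : ℕ} (u : Fin k → α) : Prop :=
  ∀ a b c d : Fin k, a < b → b < c → c < d →
    Crosses P (u a) (u b) (u d) (u c) ∧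
    ¬ Crosses P (u a) (u c) (u b) (u d) ∧
    ¬ Crosses P (u a) (u b) (u c) (u d)

/-- `P` is generalized twisted: it is Π4°-free and every induced subconfiguration on
five elements is of twisted type (i.e. can be labelled so as to form a `T_5`). -/
def GenTwisted (P : PreRotSys α) : Prop :=
  Pi4Free P ∧
    ∀ w : Fin 5 → α, Function.Injective w →
      ∃ e : Equiv.Perm (Fin 5), TwistedTuple P (fun x => w (e x))

/-- `P` contains `T_k`, the perfect twisted drawing on `k` vertices. -/
def ContainsT (P : PreRotSys α) (k : ℕ) : Prop :=
  ∃ u : Fin k → α, Function.Injective u ∧ TwistedTuple P u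

end Defs

namespace PreRotSys

section Rotation

variable {α : Type*} [Fintype α] [DecidableEq α] {P : PreRotSys α} {v b c d e : α}

theorem isCycleOn_rot (P : PreRotSys α) (v : α) :
    (P.rot v).IsCycleOn (Finset.univ.erase v : Finset α) := by
  obtain ⟨hfix, hreach⟩ := P.cyc v
  have hv : P.rot v v = v := hfix v (by simp)
  refine ⟨Equiv.bijOn _ fun x => ?_, fun x hx y hy => ?_⟩
  · have h : P.rot v x = v ↔ x = v :=
      ⟨fun h => (P.rot v).injective (h.trans hv.symm), fun h => h ▸ hv⟩
    simp [h]
  · obtain ⟨k, hk⟩ := hreach x hx y hy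
    exact ⟨k, by rwa [zpow_natCast, Equiv.Perm.coe_pow]⟩

/-- `b, c, d` are distinct from `v` and appear in this cyclic order around `v`. -/
def Btw (P : PreRotSys α) (v b c d : α) : Prop :=
  b ≠ v ∧ rotOrd P v b c d

theorem btw_iff : P.Btw v b c d ↔ b ≠ v ∧ ∃ i j : ℕ, 0 < i ∧ i < j ∧
    j < (Finset.univ.erase v).card ∧ (P.rot v ^ i) b = c ∧ (P.rot v ^ j) b = d := by
  simp only [Btw, rotOrd, CycOrd, Equiv.Perm.coe_pow]

theorem Btw.rotate (h : P.Btw v b c d) : P.Btw v c d b := by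
  rw [btw_iff] at h ⊢
  obtain ⟨hb, i, j, hi, hij, hj, rfl, rfl⟩ := h
  have hcyc := P.isCycleOn_rot v
  have hb' : b ∈ Finset.univ.erase v := by simpa using hb
  have hcard := hcyc.pow_card_apply hb'
  refine ⟨?_, j - i, _ - i, by omega, Nat.sub_lt_sub_right hij.le hj, by omega, ?_, ?_⟩
  · have := (hcyc.1.mapsTo.perm_pow i) hb'
    simpa using this
  · rw [← Equiv.Perm.mul_apply, ← pow_add, Nat.sub_add_cancel hij.le]
  · rwa [← Equiv.Perm.mul_apply, ← pow_add, Nat.sub_add_cancel (hij.trans hj).le]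

theorem pow_rot_inj (hb : b ≠ v) {i j : ℕ} (hi : i < (Finset.univ.erase v).card)
    (hj : j < (Finset.univ.erase v).card) (h : (P.rot v ^ i) b = (P.rot v ^ j) b) : i = j :=
  Nat.ModEq.eq_of_lt_of_lt
    (((P.isCycleOn_rot v).pow_apply_eq_pow_apply (by simpa using hb)).1 h) hi hj

theorem Btw.asymm (h : P.Btw v b c d) : ¬ P.Btw v b d c := by
  rw [btw_iff] at h ⊢
  rintro ⟨hb, i', j', -, hij', hj', hc, hd⟩
  obtain ⟨-, i, j, -, hij, hj, rfl, rfl⟩ := h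
  have := pow_rot_inj hb (hij'.trans hj') hj hc
  have := pow_rot_inj hb hj' (hij.trans hj) hd
  omega

theorem Btw.trans (h : P.Btw v b c d) (h' : P.Btw v b d e) : P.Btw v b c e := by
  rw [btw_iff] at h h' ⊢
  obtain ⟨hb, i, j, hi, hij, hj, hc, hd⟩ := h
  obtain ⟨-, i', j', -, hij', hj', hd', he⟩ := h'
  have := pow_rot_inj hb hj (hij'.trans hj') (hd.trans hd'.symm)
  exact ⟨hb, i, j', hi, by omega, hj', hc, he⟩

theorem btw_total (hb : b ≠ v) (hc : c ≠ v) (hd : d ≠ v) (hbc : b ≠ c) (hbd : b ≠ d)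
    (hcd : c ≠ d) : P.Btw v b c d ∨ P.Btw v b d c := by
  have hcyc := P.isCycleOn_rot v
  obtain ⟨i, hi, rfl⟩ := hcyc.exists_pow_eq (a := b) (b := c) (by simpa using hb) (by simpa using hc)
  obtain ⟨j, hj, rfl⟩ := hcyc.exists_pow_eq (a := b) (b := d) (by simpa using hb) (by simpa using hd)
  have hi0 : 0 < i := Nat.pos_of_ne_zero fun h => hbc (by simp [h])
  have hj0 : 0 < j := Nat.pos_of_ne_zero fun h => hbd (by simp [h])
  have hij : i ≠ j := fun h => hcd (by rw [h])
  simp only [btw_iff]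
  rcases hij.lt_or_gt with h | h
  · exact .inl ⟨hb, i, j, hi0, h, hj, rfl, rfl⟩
  · exact .inr ⟨hb, j, i, hj0, h, hi, rfl, rfl⟩

end Rotation

section Crossing

variable {α : Type*} [Fintype α] [DecidableEq α] {P : PreRotSys α} {p q r s : α}

theorem crosses_iff : Crosses P p q r s ↔
    (p ≠ q ∧ p ≠ r ∧ p ≠ s ∧ q ≠ r ∧ q ≠ s ∧ r ≠ s) ∧
    ((P.Btw p q r s ∧ P.Btw q p r s ∧ P.Btw r p q s ∧ P.Btw s p q r) ∨
     (P.Btw p q s r ∧ P.Btw q p s r ∧ P.Btw r p s q ∧ P.Btw s p r q)) := by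
  unfold Crosses
  refine and_congr_right fun ⟨hpq, hpr, hps, _⟩ => ?_
  simp [Btw, hpq, hpr, hps, hpq.symm]

theorem crosses_swap_right (h : Crosses P p q r s) : Crosses P p s r q := by
  rw [crosses_iff] at h ⊢
  obtain ⟨⟨hpq, hpr, hps, hqr, hqs, hrs⟩, h⟩ := h
  refine ⟨⟨hps, hpr, hpq, hrs.symm, hqs.symm, hqr.symm⟩, ?_⟩
  rcases h with ⟨h₁, h₂, h₃, h₄⟩ | ⟨h₁, h₂, h₃, h₄⟩
  · exact .inr ⟨h₁.rotate.rotate, h₄, h₃, h₂⟩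
  · exact .inl ⟨h₁.rotate, h₄, h₃, h₂⟩

theorem crosses_swap_pairs (h : Crosses P p q r s) : Crosses P q p s r := by
  rw [crosses_iff] at h ⊢
  obtain ⟨⟨hpq, hpr, hps, hqr, hqs, hrs⟩, h⟩ := h
  refine ⟨⟨hpq.symm, hqs, hqr, hps, hpr, hrs.symm⟩, ?_⟩
  rcases h with ⟨h₁, h₂, h₃, h₄⟩ | ⟨h₁, h₂, h₃, h₄⟩
  · exact .inr ⟨h₂, h₁, h₄.rotate, h₃.rotate⟩
  · exact .inl ⟨h₂, h₁, h₄.rotate.rotate, h₃.rotate.rotate⟩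

end Crossing

section LinkType

variable {α : Type*} [Fintype α] [DecidableEq α] {P : PreRotSys α} {a b c d : α} {t : ℕ}

/-- The crossing pair of disjoint edges among `a, b, c, d` is `ab, cd` for `t = 0`,
`ac, bd` for `t = 1`, and `ad, bc` for `t = 2`. -/
def HasType (P : PreRotSys α) (a b c d : α) : ℕ → Prop
  | 0 => Crosses P a c b d
  | 1 => Crosses P a b c d
  | 2 => Crosses P a b d c
  | _ => False

/-- `b, c, d` appear around `v` in this cyclic order if `σ` is true, and in the reverse
cyclic order if `σ` is false. -/
def Sense (P : PreRotSys α) (σ : Bool) (v b c d : α) : Prop :=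
  bif σ then P.Btw v b c d else P.Btw v b d c

theorem Sense.unique {v : α} {σ τ : Bool} (h : P.Sense σ v b c d) (h' : P.Sense τ v b c d) :
    σ = τ := by
  cases σ <;> cases τ <;> first | rfl | exact absurd h h'.asymm

/-- The type of a quadruple in terms of the senses of its four rotations, or `3` if no pair of
edges crosses. -/
def senseType (x y z w : Bool) : ℕ :=
  if x = y ∧ z = w then if x = z then 1 else 2 else if x = w ∧ y = z then 0 else 3

theorem HasType.exists_sense (h : P.HasType a b c d t) :
    ∃ x y z w : Bool, P.Sense x a b c d ∧ P.Sense y b a c d ∧ P.Sense z c a b d ∧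
      P.Sense w d a b c ∧ senseType x y z w = t := by
  match t with
  | 0 =>
    obtain ⟨-, ⟨h₁, h₂, h₃, h₄⟩ | ⟨h₁, h₂, h₃, h₄⟩⟩ := crosses_iff.1 h
    · exact ⟨false, true, true, false, h₁.rotate, h₃, h₂, h₄, rfl⟩
    · exact ⟨true, false, false, true, h₁.rotate.rotate, h₃, h₂, h₄, rfl⟩
  | 1 =>
    obtain ⟨-, ⟨h₁, h₂, h₃, h₄⟩ | ⟨h₁, h₂, h₃, h₄⟩⟩ := crosses_iff.1 h
    · exact ⟨true, true, true, true, h₁, h₂, h₃, h₄, rfl⟩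
    · exact ⟨false, false, false, false, h₁, h₂, h₃, h₄, rfl⟩
  | 2 =>
    obtain ⟨-, ⟨h₁, h₂, h₃, h₄⟩ | ⟨h₁, h₂, h₃, h₄⟩⟩ := crosses_iff.1 h
    · exact ⟨false, false, true, true, h₁, h₂, h₄, h₃, rfl⟩
    · exact ⟨true, true, false, false, h₁, h₂, h₄, h₃, rfl⟩

theorem HasType.unique {t' : ℕ} (h : P.HasType a b c d t) (h' : P.HasType a b c d t') :
    t = t' := by
  obtain ⟨x, y, z, w, hx, hy, hz, hw, rfl⟩ := h.exists_sense
  obtain ⟨x', y', z', w', hx', hy', hz', hw', rfl⟩ := h'.exists_sense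
  rw [hx.unique hx', hy.unique hy', hz.unique hz', hw.unique hw']

/-- One of the intervals spanned by `{a, b}` and `{c, d}` contains the other. -/
def Nested {k : ℕ} (a b c d : Fin k) : Prop :=
  (min a b < min c d ∧ max c d < max a b) ∨ (min c d < min a b ∧ max a b < max c d)

instance {k : ℕ} (a b c d : Fin k) : Decidable (Nested a b c d) :=
  inferInstanceAs (Decidable (_ ∨ _))

theorem crosses_of_nested {k : ℕ} {x : Fin k → α} (hx : TwistedTuple P x) {a b c d : Fin k}
    (hab : a ≠ b) (hcd : c ≠ d) (h : Nested a b c d) : Crosses P (x a) (x c) (x b) (x d) := by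
  wlog hab' : a < b generalizing a b
  · refine crosses_swap_pairs (crosses_swap_right (crosses_swap_pairs (this hab.symm ?_ ?_)))
    · simpa only [Nested, min_comm b, max_comm b] using h
    · exact hab.lt_or_gt.resolve_left hab'
  wlog hcd' : c < d generalizing c d
  · refine crosses_swap_right (this hcd.symm ?_ ?_)
    · simpa only [Nested, min_comm d, max_comm d] using h
    · exact hcd.lt_or_gt.resolve_left hcd'
  rw [Nested, min_eq_left hab'.le, min_eq_left hcd'.le, max_eq_right hab'.le,
    max_eq_right hcd'.le] at h
  rcases h with ⟨h₁, h₂⟩ | ⟨h₁, h₂⟩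
  · exact (hx a c d b h₁ hcd' h₂).1
  · exact crosses_swap_pairs (hx c a b d h₁ hab' h₂).1

/-- The type of the quadruple at positions `a, b, c, d` of a twisted tuple. -/
def linkType {k : ℕ} (a b c d : Fin k) : ℕ :=
  if Nested a b c d then 0 else if Nested a c b d then 1 else 2

theorem nested_of_not_nested : ∀ a b c d : Fin 5, [a, b, c, d].Nodup →
    ¬ Nested a b c d → ¬ Nested a c b d → Nested a d b c := by
  decide +kernel

theorem hasType_linkType {x : Fin 5 → α} (hx : TwistedTuple P x) {a b c d : Fin 5}
    (h : [a, b, c, d].Nodup) : P.HasType (x a) (x b) (x c) (x d) (linkType a b c d) := by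
  have h' := h
  simp only [List.nodup_cons, List.mem_cons, List.not_mem_nil, or_false, not_or] at h'
  unfold linkType
  split_ifs with h₁ h₂
  · exact crosses_of_nested hx h'.1.1 h'.2.2.1 h₁
  · exact crosses_of_nested hx h'.1.2.1 h'.2.1.2 h₂
  · exact crosses_of_nested hx h'.1.2.2 h'.2.1.1 (nested_of_not_nested a b c d h h₁ h₂)

/-- The `n`-th binary digit of `m`. -/
def bitSet (m n : ℕ) : Bool :=
  Nat.beq (Nat.land (Nat.shiftRight m n) 1) 1

/-- The types of `abcd, abce, abde, acde, bcde` that occur in a twisted configuration on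
`a, b, c, d, e`, encoded as the binary digits of a number. -/
def goodTypes (t₀ t₁ t₂ t₃ t₄ : ℕ) : Bool :=
  bitSet 10855645787700635864978336553279243619206998793367960801956762447562023150
    (t₀ + 3 * t₁ + 9 * t₂ + 27 * t₃ + 81 * t₄)

theorem goodTypes_linkType : ∀ a b c d e : Fin 5, [a, b, c, d, e].Nodup →
    goodTypes (linkType a b c d) (linkType a b c e) (linkType a b d e) (linkType a c d e)
      (linkType b c d e) = true := by
  decide +kernel

theorem exists_goodTypes (hP : GenTwisted P) {a b c d e : α} (h : [a, b, c, d, e].Nodup) :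
    ∃ t₀ t₁ t₂ t₃ t₄ : ℕ, P.HasType a b c d t₀ ∧ P.HasType a b c e t₁ ∧ P.HasType a b d e t₂ ∧
      P.HasType a c d e t₃ ∧ P.HasType b c d e t₄ ∧ goodTypes t₀ t₁ t₂ t₃ t₄ = true := by
  obtain ⟨f, hf⟩ := hP.2 [a, b, c, d, e].get (List.nodup_iff_injective_get.1 h)
  have key {i j k l : Fin 5} (hn : [i, j, k, l].Nodup) :=
    hasType_linkType hf (hn.map f.symm.injective)
  simp only [Equiv.apply_symm_apply] at key
  have hn : ([0, 1, 2, 3, 4] : List (Fin 5)).Nodup := by decide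
  exact ⟨_, _, _, _, _, key (i := 0) (j := 1) (k := 2) (l := 3) (by decide),
    key (i := 0) (j := 1) (k := 2) (l := 4) (by decide),
    key (i := 0) (j := 1) (k := 3) (l := 4) (by decide),
    key (i := 0) (j := 2) (k := 3) (l := 4) (by decide),
    key (i := 1) (j := 2) (k := 3) (l := 4) (by decide),
    goodTypes_linkType _ _ _ _ _ (hn.map f.symm.injective)⟩

end LinkType

section Scan

/-- The cyclic order of three elements in a possibly incomplete cyclic list. -/
inductive CycSign
  | pos
  | neg
  | unknown

namespace CycSign

/-- The proposition asserted by a sign. -/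
def Holds : CycSign → Prop → Prop → Prop
  | pos, p, _ => p
  | neg, _, q => q
  | unknown, _, _ => True

/-- The sign of a Boolean. -/
def ofBool (σ : Bool) : CycSign :=
  bif σ then pos else neg

end CycSign

/-- `s` if `d` is in the list `L`. -/
def containsThen (d : ℕ) (s : CycSign) (L : List ℕ) : CycSign :=
  List.rec .unknown (fun x _ r => Bool.rec r s (Nat.beq x d)) L

/-- The order in which `c` and `d` appear in the list `L`. -/
def scanTwo (c d : ℕ) (L : List ℕ) : CycSign :=
  List.rec .unknown (fun x t r =>
    Bool.rec (Bool.rec r (containsThen c .neg t) (Nat.beq x d))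
      (containsThen d .pos t) (Nat.beq x c)) L

/-- The cyclic order in which `b`, `c` and `d` appear in the cyclic list `L`. -/
def scanThree (b c d : ℕ) (L : List ℕ) : CycSign :=
  List.rec .unknown (fun x t r =>
    Bool.rec (Bool.rec (Bool.rec r (scanTwo b c t) (Nat.beq x d)) (scanTwo d b t) (Nat.beq x c))
      (scanTwo c d t) (Nat.beq x b)) L

variable {b c d : ℕ} {L : List ℕ} {p q : Prop}

theorem containsThen_holds {s : CycSign} (h : d ∈ L → s.Holds p q) :
    (containsThen d s L).Holds p q := by
  induction L with
  | nil => trivial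
  | cons x t ih =>
    change CycSign.Holds (Bool.rec (containsThen d s t) s (Nat.beq x d)) p q
    cases hx : Nat.beq x d
    · exact ih fun hd => h (List.mem_cons_of_mem _ hd)
    · exact h (Nat.eq_of_beq_eq_true hx ▸ List.mem_cons_self)

theorem scanTwo_holds (hp : [c, d].Sublist L → p) (hq : [d, c].Sublist L → q) :
    (scanTwo c d L).Holds p q := by
  induction L with
  | nil => trivial
  | cons x t ih =>
    change CycSign.Holds (Bool.rec (Bool.rec (scanTwo c d t) (containsThen c .neg t) (Nat.beq x d))
      (containsThen d .pos t) (Nat.beq x c)) p q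
    cases hc : Nat.beq x c
    · cases hd : Nat.beq x d
      · exact ih (fun h => hp (h.cons _)) fun h => hq (h.cons _)
      · obtain rfl := Nat.eq_of_beq_eq_true hd
        exact containsThen_holds fun h => hq ((List.singleton_sublist.2 h).cons_cons _)
    · obtain rfl := Nat.eq_of_beq_eq_true hc
      exact containsThen_holds fun h => hp ((List.singleton_sublist.2 h).cons_cons _)

theorem scanThree_holds (hp₁ : [b, c, d].Sublist L → p) (hp₂ : [c, d, b].Sublist L → p)
    (hp₃ : [d, b, c].Sublist L → p) (hq₁ : [b, d, c].Sublist L → q)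
    (hq₂ : [d, c, b].Sublist L → q) (hq₃ : [c, b, d].Sublist L → q) :
    (scanThree b c d L).Holds p q := by
  induction L with
  | nil => trivial
  | cons x t ih =>
    change CycSign.Holds (Bool.rec (Bool.rec (Bool.rec (scanThree b c d t) (scanTwo b c t)
      (Nat.beq x d)) (scanTwo d b t) (Nat.beq x c)) (scanTwo c d t) (Nat.beq x b)) p q
    cases hb : Nat.beq x b
    · cases hc : Nat.beq x c
      · cases hd : Nat.beq x d
        · exact ih (fun h => hp₁ (h.cons _)) (fun h => hp₂ (h.cons _)) (fun h => hp₃ (h.cons _))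
            (fun h => hq₁ (h.cons _)) (fun h => hq₂ (h.cons _)) (fun h => hq₃ (h.cons _))
        · obtain rfl := Nat.eq_of_beq_eq_true hd
          exact scanTwo_holds (fun h => hp₃ (h.cons_cons _)) fun h => hq₂ (h.cons_cons _)
      · obtain rfl := Nat.eq_of_beq_eq_true hc
        exact scanTwo_holds (fun h => hp₂ (h.cons_cons _)) fun h => hq₃ (h.cons_cons _)
    · obtain rfl := Nat.eq_of_beq_eq_true hb
      exact scanTwo_holds (fun h => hp₁ (h.cons_cons _)) fun h => hq₁ (h.cons_cons _)

end Scan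

section Table

/-- A table of partial rotations: the row at index `v` is a cyclic list of neighbours of `v`. -/
abbrev Table := List (List ℕ)

/-- The row of a table at an index, empty if the index is out of range. -/
def row (S : Table) (v : ℕ) : List ℕ :=
  (List.rec (fun _ => []) (fun M _ r v => Bool.rec (r (Nat.pred v)) M (Nat.beq v 0)) S :
    ℕ → List ℕ) v

/-- `senseType` for signs: `3` if no pair of edges can cross, and `4` if the type may depend on
unknown signs. -/
noncomputable def signType (x y z w : CycSign) : ℕ :=
  CycSign.rec
    (CycSign.rec (CycSign.rec (CycSign.rec 1 3 4 z) (CycSign.rec 3 2 4 z) 4 w)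
      (CycSign.rec (CycSign.rec 3 0 4 z) 3 (CycSign.rec 3 4 4 z) w) 4 y)
    (CycSign.rec (CycSign.rec 3 (CycSign.rec 0 3 4 z) (CycSign.rec 4 3 4 z) w)
      (CycSign.rec (CycSign.rec 2 3 4 z) (CycSign.rec 3 1 4 z) 4 w) 4 y) 4 x

/-- The type of a quadruple in a table. -/
noncomputable def tableType (S : Table) (a b c d : ℕ) : ℕ :=
  signType (scanThree b c d (row S a)) (scanThree a c d (row S b)) (scanThree a b d (row S c))
    (scanThree a b c (row S d))

theorem signType_eq {x y z w : Bool} {s₁ s₂ s₃ s₄ : CycSign}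
    (h₁ : s₁ = .unknown ∨ s₁ = .ofBool x) (h₂ : s₂ = .unknown ∨ s₂ = .ofBool y)
    (h₃ : s₃ = .unknown ∨ s₃ = .ofBool z) (h₄ : s₄ = .unknown ∨ s₄ = .ofBool w) :
    signType s₁ s₂ s₃ s₄ = senseType x y z w ∨ signType s₁ s₂ s₃ s₄ = 4 := by
  rcases h₁ with rfl | rfl <;> rcases h₂ with rfl | rfl <;> rcases h₃ with rfl | rfl <;>
    rcases h₄ with rfl | rfl <;> revert x y z w <;> decide

variable {α : Type*} [Fintype α] [DecidableEq α] {P : PreRotSys α} {u : ℕ → α}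

/-- The list `L` is in cyclic order around `v` under the labelling `u`. -/
def CycSorted (P : PreRotSys α) (u : ℕ → α) (v : ℕ) : List ℕ → Prop
  | [] => True
  | h :: t => t.Pairwise fun y z => P.Btw (u v) (u h) (u y) (u z)

theorem CycSorted.btw {v x y z : ℕ} {L : List ℕ} (h : P.CycSorted u v L)
    (hs : [x, y, z].Sublist L) : P.Btw (u v) (u x) (u y) (u z) := by
  cases hs with
  | cons a hs =>
    have := List.Pairwise.sublist hs h
    simp only [List.pairwise_cons, List.mem_cons, List.not_mem_nil, or_false, forall_eq_or_imp,
      forall_eq] at this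
    obtain ⟨⟨hxy, hxz⟩, hyz, -⟩ := this
    exact (hyz.rotate.trans hxy.rotate.rotate).rotate.rotate
  | cons_cons _ hs => simpa using List.Pairwise.sublist hs h

/-- All rows of the table `S` are in cyclic order under the labelling `u`. -/
structure Realizes (P : PreRotSys α) (u : ℕ → α) (S : Table) : Prop where
  cycSorted : ∀ v, P.CycSorted u v (row S v)
  nodup : ∀ v, (v :: row S v).Nodup
  lt : ∀ v, ∀ x ∈ row S v, x < 7

variable {S : Table}

theorem Realizes.scanThree_holds (h : P.Realizes u S) (v b c d : ℕ) :
    (scanThree b c d (row S v)).Holds (P.Btw (u v) (u b) (u c) (u d))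
      (P.Btw (u v) (u b) (u d) (u c)) :=
  PreRotSys.scanThree_holds (fun hs => (h.cycSorted v).btw hs)
    (fun hs => ((h.cycSorted v).btw hs).rotate.rotate) (fun hs => ((h.cycSorted v).btw hs).rotate)
    (fun hs => (h.cycSorted v).btw hs) (fun hs => ((h.cycSorted v).btw hs).rotate.rotate)
    (fun hs => ((h.cycSorted v).btw hs).rotate)

theorem Sense.eq_ofBool {v b c d : α} {σ : Bool} {s : CycSign} (h : P.Sense σ v b c d)
    (hs : s.Holds (P.Btw v b c d) (P.Btw v b d c)) : s = .unknown ∨ s = .ofBool σ := by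
  cases s with
  | pos => exact .inr (congrArg CycSign.ofBool (Sense.unique (σ := true) hs h))
  | neg => exact .inr (congrArg CycSign.ofBool (Sense.unique (σ := false) hs h))
  | unknown => exact .inl rfl

theorem Realizes.tableType_eq (hS : P.Realizes u S) {a b c d t : ℕ}
    (h : P.HasType (u a) (u b) (u c) (u d) t) : tableType S a b c d = t ∨
      tableType S a b c d = 4 := by
  obtain ⟨x, y, z, w, hx, hy, hz, hw, rfl⟩ := h.exists_sense
  exact signType_eq (hx.eq_ofBool (hS.scanThree_holds ..)) (hy.eq_ofBool (hS.scanThree_holds ..))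
    (hz.eq_ofBool (hS.scanThree_holds ..)) (hw.eq_ofBool (hS.scanThree_holds ..))

end Table

section Search

/-- All elements of `L` satisfy `f`. -/
def allTrue {β : Type*} (f : β → Bool) (L : List β) : Bool :=
  List.rec true (fun p _ r => Bool.rec false r (f p)) L

theorem allTrue_iff {β : Type*} {f : β → Bool} {L : List β} :
    allTrue f L = true ↔ ∀ p ∈ L, f p = true := by
  induction L with
  | nil => simp [allTrue]
  | cons p t ih =>
    have : allTrue f (p :: t) = Bool.rec false (allTrue f t) (f p) := rfl
    rw [this, List.forall_mem_cons, ← ih]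
    cases f p <;> simp

/-- The continuation `k` holds for all lists obtained by inserting `x` into `L`. -/
def allInsertions (x : ℕ) (L : List ℕ) : (List ℕ → Bool) → Bool :=
  List.rec (fun k => k [x])
    (fun y t r k => Bool.rec false (r fun L' => k (y :: L')) (k (x :: y :: t))) L

/-- The continuation `k` holds for all cyclic lists obtained by inserting `x` into `L`. -/
def allCyclicInsertions (x : ℕ) (L : List ℕ) (k : List ℕ → Bool) : Bool :=
  List.rec (k [x]) (fun h t _ => allInsertions x t fun L' => k (h :: L')) L

/-- Apply the continuation `k` to the table `S` with the row at `v` replaced by `L`. -/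
def withRow (L : List ℕ) (S : Table) : ℕ → (Table → Bool) → Bool :=
  List.rec (fun _ k => k []) (fun M T r v k =>
    Bool.rec (r (Nat.pred v) fun T' => k (M :: T')) (k (L :: T)) (Nat.beq v 0)) S

theorem exists_of_allInsertions {x : ℕ} {L : List ℕ} {k : List ℕ → Bool} {r : ℕ → ℕ → Prop}
    (h : allInsertions x L k = true) (hL : L.Pairwise r)
    (htrans : ∀ a b c, r a b → r b c → r a c) (htotal : ∀ y ∈ L, r x y ∨ r y x) :
    ∃ L' : List ℕ, L'.Pairwise r ∧ L'.Perm (x :: L) ∧ k L' = true := by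
  induction L generalizing k with
  | nil => exact ⟨[x], by simp, .rfl, h⟩
  | cons y t ih =>
    have heq : allInsertions x (y :: t) k = Bool.rec false (allInsertions x t fun L' => k (y :: L'))
      (k (x :: y :: t)) := rfl
    rw [heq] at h
    cases hk : k (x :: y :: t)
    · simp [hk] at h
    rw [hk] at h
    rw [List.pairwise_cons] at hL
    rcases htotal y List.mem_cons_self with hxy | hyx
    · refine ⟨_, ?_, .rfl, hk⟩
      simp only [List.pairwise_cons, List.forall_mem_cons]
      exact ⟨⟨hxy, fun z hz => htrans _ _ _ hxy (hL.1 z hz)⟩, hL⟩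
    · obtain ⟨L', hL', hperm, hk'⟩ := ih h hL.2 fun z hz => htotal z (List.mem_cons_of_mem _ hz)
      refine ⟨y :: L', List.pairwise_cons.2 ⟨fun z hz => ?_, hL'⟩,
        (hperm.cons y).trans (.swap x y t), hk'⟩
      rcases List.mem_cons.1 (hperm.subset hz) with rfl | hz
      exacts [hyx, hL.1 z hz]

theorem exists_of_withRow {L : List ℕ} {S : Table} {v : ℕ} {k : Table → Bool}
    (h : withRow L S v k = true) :
    ∃ S', k S' = true ∧ ∀ w, row S' w = row S w ∨ w = v ∧ row S' w = L := by
  induction S generalizing v k with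
  | nil => exact ⟨[], h, fun _ => .inl rfl⟩
  | cons M T ih =>
    have heq : withRow L (M :: T) v k = Bool.rec (withRow L T (Nat.pred v) fun T' => k (M :: T'))
      (k (L :: T)) (Nat.beq v 0) := rfl
    rw [heq] at h
    cases v with
    | zero =>
      refine ⟨_, h, fun w => ?_⟩
      cases w
      exacts [.inr ⟨rfl, rfl⟩, .inl rfl]
    | succ v =>
      obtain ⟨S', hS', hw⟩ := ih h
      refine ⟨_, hS', fun w => ?_⟩
      cases w with
      | zero => exact .inl rfl
      | succ w => exact (hw w).imp_right fun h => ⟨congrArg _ h.1, h.2⟩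

/-- The insertion of `new` into the row at `vertex`. Afterwards, for all `(a, b)` in `quads`, the
type of `a, b, vertex, new` has to be a binary digit of `types`, and for all `(a, b, c)` in
`triples`, the elements `a, b, c, vertex, new` have to form a twisted configuration. -/
structure Step where
  vertex : ℕ
  new : ℕ
  types : ℕ
  quads : List (ℕ × ℕ)
  triples : List (ℕ × ℕ × ℕ)

/-- The test for the elements of `Step.quads`. -/
noncomputable def quadOk (S : Table) (s : Step) (p : ℕ × ℕ) : Bool :=
  bitSet s.types (tableType S p.1 p.2 s.vertex s.new)

/-- `goodTypes` for types of a table, where `4` is an unknown type. -/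
def goodOrUnknown (t₀ t₁ t₂ t₃ t₄ : ℕ) : Bool :=
  goodTypes t₀ t₁ t₂ t₃ t₄ ||
    (Nat.beq t₀ 4 || Nat.beq t₁ 4 || Nat.beq t₂ 4 || Nat.beq t₃ 4 || Nat.beq t₄ 4)

/-- The test for the elements of `Step.triples`. -/
noncomputable def tripleOk (S : Table) (s : Step) (p : ℕ × ℕ × ℕ) : Bool :=
  goodOrUnknown (tableType S p.1 p.2.1 p.2.2 s.vertex) (tableType S p.1 p.2.1 p.2.2 s.new)
    (tableType S p.1 p.2.1 s.vertex s.new) (tableType S p.1 p.2.2 s.vertex s.new)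
    (tableType S p.2.1 p.2.2 s.vertex s.new)

/-- The tests of a step. -/
noncomputable def stepOk (S : Table) (s : Step) : Bool :=
  Bool.rec false (allTrue (tripleOk S s) s.triples) (allTrue (quadOk S s) s.quads)

/-- All completions of the table by the given steps that pass the tests satisfy `fin`. -/
noncomputable def search (fin : Table → Bool) (L : List Step) : Table → Bool :=
  List.rec fin (fun s _ r S =>
    Bool.rec
      (allCyclicInsertions s.new (row S s.vertex) fun L =>
        withRow L S s.vertex fun S' => Bool.rec true (r S') (stepOk S' s))
      false (List.any (row S s.vertex) (Nat.beq s.new))) L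

variable {α : Type*} [Fintype α] [DecidableEq α] {P : PreRotSys α} {u : ℕ → α} {S : Table}

theorem Realizes.exists_of_allCyclicInsertions (hu : Set.InjOn u (Set.Iio 7))
    (hS : P.Realizes u S) {v n : ℕ} {k : List ℕ → Bool} (hv : v < 7) (hn : n < 7) (hvn : n ≠ v)
    (hrow : n ∉ row S v) (h : allCyclicInsertions n (row S v) k = true) :
    ∃ L, P.CycSorted u v L ∧ L.Perm (n :: row S v) ∧ k L = true := by
  have hsort := hS.cycSorted v
  have hlt := hS.lt v
  have hnodup := hS.nodup v
  cases hL : row S v with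
  | nil =>
    rw [hL] at h
    exact ⟨[n], List.Pairwise.nil, .rfl, h⟩
  | cons a t =>
    rw [hL] at h hsort hlt hnodup hrow
    simp only [List.nodup_cons, List.mem_cons, not_or] at hrow hnodup
    have hne {x y : ℕ} (hx : x < 7) (hy : y < 7) (hxy : x ≠ y) : u x ≠ u y :=
      fun h => hxy (hu hx hy h)
    have ha := hlt a List.mem_cons_self
    have htotal (y : ℕ) (hy : y ∈ t) :
        P.Btw (u v) (u a) (u n) (u y) ∨ P.Btw (u v) (u a) (u y) (u n) := by
      have hy' := hlt y (List.mem_cons_of_mem _ hy)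
      exact btw_total (hne ha hv (Ne.symm hnodup.1.1)) (hne hn hv hvn)
        (hne hy' hv fun h => hnodup.1.2 (h ▸ hy)) (hne ha hn (Ne.symm hrow.1))
        (hne ha hy' fun h => hnodup.2.1 (h ▸ hy)) (hne hn hy' fun h => hrow.2 (h ▸ hy))
    obtain ⟨L', hL', hperm, hk⟩ := exists_of_allInsertions h hsort
      (fun _ _ _ => Btw.trans) htotal
    exact ⟨a :: L', hL', (hperm.cons a).trans (.swap n a t), hk⟩

/-- The tests of the step succeed for all tables realized by the labelling. -/
def StepSound (P : PreRotSys α) (u : ℕ → α) (s : Step) : Prop :=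
  s.vertex < 7 ∧ s.new < 7 ∧ s.new ≠ s.vertex ∧ ∀ S, P.Realizes u S → stepOk S s = true

theorem Realizes.exists_of_search (hu : Set.InjOn u (Set.Iio 7)) {fin : Table → Bool}
    {L : List Step} (hL : ∀ s ∈ L, P.StepSound u s) (hS : P.Realizes u S)
    (h : search fin L S = true) : ∃ S', P.Realizes u S' ∧ fin S' = true := by
  induction L generalizing S with
  | nil => exact ⟨S, hS, h⟩
  | cons s L ih =>
    obtain ⟨⟨hv, hn, hne, hok⟩, hL⟩ := List.forall_mem_cons.1 hL
    have heq : search fin (s :: L) S = Bool.rec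
      (allCyclicInsertions s.new (row S s.vertex) fun M =>
        withRow M S s.vertex fun S' => Bool.rec true (search fin L S') (stepOk S' s))
      false (List.any (row S s.vertex) (Nat.beq s.new)) := rfl
    rw [heq] at h
    cases hany : List.any (row S s.vertex) (Nat.beq s.new)
    · rw [hany] at h
      have hmem : s.new ∉ row S s.vertex := fun h => by simpa using List.any_eq_false.1 hany _ h
      obtain ⟨M, hsort, hperm, hM⟩ := hS.exists_of_allCyclicInsertions hu hv hn hne hmem h
      obtain ⟨S', hk, hrow⟩ := exists_of_withRow hM
      have hS' : P.Realizes u S' := by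
        constructor <;> intro w <;> rcases hrow w with hw | ⟨rfl, hw⟩ <;> rw [hw]
        · exact hS.cycSorted w
        · exact hsort
        · exact hS.nodup w
        · rw [(hperm.cons _).nodup_iff, (List.Perm.swap ..).nodup_iff, List.nodup_cons]
          simp [hS.nodup, hmem, hne]
        · exact hS.lt w
        · intro x hx
          rcases List.mem_cons.1 (hperm.subset hx) with rfl | hx
          exacts [hn, hS.lt _ x hx]
      rw [hok S' hS'] at hk
      exact ih hL hS' hk
    · simp [hany] at h

theorem goodOrUnknown_eq_true {s₀ s₁ s₂ s₃ s₄ t₀ t₁ t₂ t₃ t₄ : ℕ}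
    (h : goodTypes t₀ t₁ t₂ t₃ t₄ = true) (h₀ : s₀ = t₀ ∨ s₀ = 4) (h₁ : s₁ = t₁ ∨ s₁ = 4)
    (h₂ : s₂ = t₂ ∨ s₂ = 4) (h₃ : s₃ = t₃ ∨ s₃ = 4) (h₄ : s₄ = t₄ ∨ s₄ = 4) :
    goodOrUnknown s₀ s₁ s₂ s₃ s₄ = true := by
  simp only [goodOrUnknown, Bool.or_eq_true, Nat.beq_eq]
  grind

theorem exists_fifth {a b c d : ℕ} (h : [a, b, c, d].Nodup) :
    ∃ e < 7, [a, b, c, d, e].Nodup := by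
  obtain ⟨e, he, h'⟩ : ∃ e < 7, e ∉ [a, b, c, d] := by
    by_contra! hall
    have h₀ := hall 0 (by norm_num)
    have h₁ := hall 1 (by norm_num)
    have h₂ := hall 2 (by norm_num)
    have h₃ := hall 3 (by norm_num)
    have h₄ := hall 4 (by norm_num)
    simp only [List.mem_cons, List.not_mem_nil, or_false] at h₀ h₁ h₂ h₃ h₄
    omega
  exact ⟨e, he, (List.nodup_append_comm (l₁ := [e]).1 (List.nodup_cons.2 ⟨h', h⟩))⟩

theorem nodup_map {α : Type*} {u : ℕ → α} (hu : Set.InjOn u (Set.Iio 7)) {l : List ℕ} (h : l.Nodup)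
    (hlt : ∀ x ∈ l, x < 7) : (l.map u).Nodup :=
  h.map_on fun _ hx _ hy => hu (hlt _ hx) (hlt _ hy)

theorem exists_hasType (hP : GenTwisted P) (hu : Set.InjOn u (Set.Iio 7)) {a b c d : ℕ}
    (h : [a, b, c, d].Nodup) (hlt : ∀ x ∈ [a, b, c, d], x < 7) :
    ∃ t < 3, P.HasType (u a) (u b) (u c) (u d) t := by
  obtain ⟨e, he, h'⟩ := exists_fifth h
  obtain ⟨t, -, -, -, -, ht, -⟩ := exists_goodTypes hP (nodup_map hu h' (by simp_all))
  refine ⟨t, ?_, ht⟩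
  match t, ht with
  | 0, _ | 1, _ | 2, _ => decide

theorem stepOk_eq_true (hP : GenTwisted P) (hu : Set.InjOn u (Set.Iio 7)) {s : Step}
    (hq : ∀ p ∈ s.quads, bitSet s.types 4 = true ∧
      ∃ t, P.HasType (u p.1) (u p.2) (u s.vertex) (u s.new) t ∧ bitSet s.types t = true)
    (ht : ∀ p ∈ s.triples, [p.1, p.2.1, p.2.2, s.vertex, s.new].Nodup ∧
      ∀ x ∈ [p.1, p.2.1, p.2.2, s.vertex, s.new], x < 7) (hS : P.Realizes u S) :
    stepOk S s = true := by
  have h₁ : allTrue (quadOk S s) s.quads = true := allTrue_iff.2 fun p hp => by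
    obtain ⟨h4, t, hpt, hbit⟩ := hq p hp
    unfold quadOk
    rcases hS.tableType_eq hpt with h | h <;> rwa [h]
  have h₂ : allTrue (tripleOk S s) s.triples = true := allTrue_iff.2 fun p hp => by
    obtain ⟨t₀, t₁, t₂, t₃, t₄, h₀, h₁, h₂, h₃, h₄, h⟩ :=
      exists_goodTypes hP (nodup_map hu (ht p hp).1 (ht p hp).2)
    exact goodOrUnknown_eq_true h (hS.tableType_eq h₀) (hS.tableType_eq h₁) (hS.tableType_eq h₂)
      (hS.tableType_eq h₃) (hS.tableType_eq h₄)
  simp [stepOk, h₁, h₂]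

end Search

section Lists

/-- The pairs of elements of a list, in the order of the list. -/
def pairs : List ℕ → List (ℕ × ℕ)
  | [] => []
  | x :: t => t.map (x, ·) ++ pairs t

/-- The triples of elements of a list, in the order of the list. -/
def triples : List ℕ → List (ℕ × ℕ × ℕ)
  | [] => []
  | x :: t => (pairs t).map (x, ·) ++ triples t

/-- The quadruples of elements of a list, in the order of the list. -/
def quadruples : List ℕ → List (ℕ × ℕ × ℕ × ℕ)
  | [] => []
  | x :: t => (triples t).map (x, ·) ++ quadruples t

variable {a b c d : ℕ} {l : List ℕ}

theorem mem_pairs (h : [a, b].Sublist l) : (a, b) ∈ pairs l := by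
  induction l with
  | nil => cases h
  | cons x t ih =>
    cases h with
    | cons _ h => exact List.mem_append_right _ (ih h)
    | cons_cons _ h =>
      exact List.mem_append_left _ (List.mem_map_of_mem (List.singleton_sublist.1 h))

theorem mem_triples (h : [a, b, c].Sublist l) : (a, b, c) ∈ triples l := by
  induction l with
  | nil => cases h
  | cons x t ih =>
    cases h with
    | cons _ h => exact List.mem_append_right _ (ih h)
    | cons_cons _ h => exact List.mem_append_left _ (List.mem_map_of_mem (mem_pairs h))

theorem mem_quadruples (h : [a, b, c, d].Sublist l) : (a, b, c, d) ∈ quadruples l := by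
  induction l with
  | nil => cases h
  | cons x t ih =>
    cases h with
    | cons _ h => exact List.mem_append_right _ (ih h)
    | cons_cons _ h => exact List.mem_append_left _ (List.mem_map_of_mem (mem_triples h))

end Lists

section Extension

/-- The steps inserting the edges from `n` to the elements of the second list, when the edges to
the elements of the first list are already present. The allowed types for the two steps of an
edge are the binary digits of `t₁` and `t₂`. -/
def edgeSteps (t₁ t₂ n : ℕ) : List ℕ → List ℕ → List Step
  | _, [] => []
  | done, v :: vs => ⟨v, n, t₁, pairs done, []⟩ :: ⟨n, v, t₂, pairs done, triples done⟩ ::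
      edgeSteps t₁ t₂ n (done ++ [v]) vs

/-- The tuple `w` is twisted according to the table. -/
noncomputable def isTwisted (S : Table) (w : List ℕ) : Bool :=
  allTrue (fun p => Nat.beq (tableType S p.1 p.2.1 p.2.2.1 p.2.2.2) 2) (quadruples w)

/-- The renaming of the vertices given by a list of images, the identity outside its range. -/
def imageOf (l : List ℕ) (x : ℕ) : ℕ :=
  l.getD x x

/-- The table `S` contains the table `T` renamed by `π`. -/
noncomputable def isRenaming (S T : Table) (π : ℕ → ℕ) : Bool :=
  allTrue (fun v => allTrue (fun p =>
    CycSign.rec true false false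
      (scanThree (π ((row T v).headD 0)) (π p.1) (π p.2) (row S (π v))))
    (pairs (row T v).tail)) [0, 1, 2, 3, 4, 5, 6]

/-- The step is admissible for a labelling whose first five vertices are twisted. -/
def Step.Valid (s : Step) : Prop :=
  s.vertex < 7 ∧ s.new < 7 ∧ s.new ≠ s.vertex ∧
  (∀ p ∈ s.triples, [p.1, p.2.1, p.2.2, s.vertex, s.new].Nodup ∧
    ∀ x ∈ [p.1, p.2.1, p.2.2, s.vertex, s.new], x < 7) ∧
  (∀ p ∈ s.quads, [p.1, p.2, s.vertex, s.new].Nodup ∧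
    ∀ x ∈ [p.1, p.2, s.vertex, s.new], x < 7) ∧
  (s.types = 23 ∨
    (s.types = 20 ∧ ∀ p ∈ s.quads, p.1 < p.2 ∧ p.2 < s.vertex ∧ s.vertex < s.new ∧ s.new < 5) ∨
    (s.types = 18 ∧ ∀ p ∈ s.quads, p.1 < p.2 ∧ p.2 < s.new ∧ s.new < s.vertex ∧ s.vertex < 5))

instance (s : Step) : Decidable s.Valid :=
  inferInstanceAs (Decidable (_ ∧ _))

variable {α : Type*} [Fintype α] [DecidableEq α] {P : PreRotSys α} {u : ℕ → α} {S T : Table}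

theorem Step.Valid.stepSound {s : Step} (hs : s.Valid) (hP : GenTwisted P)
    (hu : Set.InjOn u (Set.Iio 7))
    (h : s.types = 23 ∨
      ∀ a b c d, a < b → b < c → c < d → d < 5 → Crosses P (u a) (u b) (u d) (u c)) :
    P.StepSound u s := by
  obtain ⟨hv, hn, hne, ht, hq, htypes⟩ := hs
  refine ⟨hv, hn, hne, fun S hS => stepOk_eq_true hP hu (fun p hp => ?_) ht hS⟩
  by_cases h23 : s.types = 23
  · obtain ⟨t, ht, hpt⟩ := exists_hasType hP hu (hq p hp).1 (hq p hp).2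
    refine ⟨by rw [h23]; decide, t, hpt, ?_⟩
    rw [h23]
    interval_cases t <;> decide
  · have h := h.resolve_left h23
    rcases htypes.resolve_left h23 with ⟨ht, hlt⟩ | ⟨ht, hlt⟩ <;>
      obtain ⟨h₁, h₂, h₃, h₄⟩ := hlt p hp <;> rw [ht]
    · exact ⟨by decide, 2, h _ _ _ _ h₁ h₂ h₃ h₄, by decide⟩
    · exact ⟨by decide, 1, h _ _ _ _ h₁ h₂ h₃ h₄, by decide⟩

theorem Realizes.containsT (hP : GenTwisted P) (hu : Set.InjOn u (Set.Iio 7))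
    (hS : P.Realizes u S) {w : List ℕ} (hw : w.Nodup) (hlt : ∀ x ∈ w, x < 7)
    (h : isTwisted S w = true) : ContainsT P w.length := by
  refine ⟨fun i => u (w.get i), fun i j hij => ?_, fun a b c d hab hbc hcd => ?_⟩
  · exact List.nodup_iff_injective_get.1 hw
      (hu (hlt _ (List.get_mem ..)) (hlt _ (List.get_mem ..)) hij)
  · have hsub : [w.get a, w.get b, w.get c, w.get d].Sublist w :=
      List.map_getElem_sublist (is := [a, b, c, d]) (by
        simp [hab, hbc, hcd, hab.trans hbc, hbc.trans hcd, (hab.trans hbc).trans hcd])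
    have h2 := Nat.eq_of_beq_eq_true (allTrue_iff.1 h _ (mem_quadruples hsub))
    obtain ⟨t, -, ht⟩ := exists_hasType hP hu (hw.sublist hsub) fun x hx => hlt x (hsub.subset hx)
    have ht2 : 2 = t ∨ 2 = 4 := h2 ▸ hS.tableType_eq ht
    obtain rfl : 2 = t := by omega
    exact ⟨ht, fun h0 => absurd (ht.unique (t' := 0) h0) (by decide),
      fun h1 => absurd (ht.unique (t' := 1) h1) (by decide)⟩

theorem row_eq_nil {v : ℕ} (h : S.length ≤ v) : row S v = [] := by
  induction S generalizing v with
  | nil => rfl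
  | cons M T ih =>
    obtain ⟨v, rfl⟩ := Nat.exists_eq_succ_of_ne_zero (Nat.ne_zero_of_lt h)
    exact ih (Nat.le_of_succ_le_succ h)

/-- The rows of the table are lists of distinct neighbours. -/
def Table.Valid (T : Table) : Prop :=
  T.length = 7 ∧ ∀ v < 7, (v :: row T v).Nodup ∧ ∀ x ∈ row T v, x < 7

instance (T : Table) : Decidable (Table.Valid T) :=
  inferInstanceAs (Decidable (_ ∧ _))

theorem Table.Valid.realizes (hT : Table.Valid T)
    (h : ∀ v < 7, P.CycSorted u v (row T v)) : P.Realizes u T where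
  cycSorted v := by
    rcases lt_or_ge v 7 with hv | hv
    · exact h v hv
    · rw [row_eq_nil (hT.1.trans_le hv)]
      trivial
  nodup v := by
    rcases lt_or_ge v 7 with hv | hv
    · exact (hT.2 v hv).1
    · simp [row_eq_nil (hT.1.trans_le hv)]
  lt v := by
    rcases lt_or_ge v 7 with hv | hv
    · exact (hT.2 v hv).2
    · simp [row_eq_nil (hT.1.trans_le hv)]

theorem Realizes.of_isRenaming (hS : P.Realizes u S) {π : ℕ → ℕ} (hT : Table.Valid T)
    (h : isRenaming S T π = true) : P.Realizes (u ∘ π) T := by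
  refine hT.realizes fun v hv => ?_
  have hv' : v ∈ [0, 1, 2, 3, 4, 5, 6] := by simp; omega
  have hrow := allTrue_iff.1 (allTrue_iff.1 h v hv')
  cases hL : row T v with
  | nil => trivial
  | cons a t =>
    rw [hL] at hrow
    refine List.pairwise_iff_forall_sublist.2 fun {c d} hcd => ?_
    have hpos := hrow _ (mem_pairs hcd)
    have hsign := hS.scanThree_holds (π v) (π a) (π c) (π d)
    simp only [List.headD_cons] at hpos
    cases hs : scanThree (π a) (π c) (π d) (row S (π v)) <;> rw [hs] at hpos hsign
    · exact hsign
    · cases hpos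
    · cases hpos

end Extension

section Certificate

/-- A rotation system on six elements that is not twisted. -/
def seedA : Table :=
  [[1, 5, 2, 3, 4], [0, 5, 2, 3, 4], [0, 3, 4, 5, 1], [0, 4, 5, 2, 1], [0, 5, 3, 2, 1],
   [0, 4, 3, 2, 1], []]

/-- A rotation system on six elements that is not twisted. -/
def seedB : Table :=
  [[1, 5, 2, 3, 4], [0, 5, 2, 3, 4], [0, 3, 4, 5, 1], [0, 4, 5, 2, 1], [0, 3, 2, 5, 1],
   [0, 3, 2, 4, 1], []]

/-- A rotation system on six elements that is not twisted. -/
def seedC : Table :=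
  [[1, 5, 2, 3, 4], [0, 5, 2, 3, 4], [0, 3, 4, 1, 5], [0, 4, 2, 1, 5], [0, 3, 2, 1, 5],
   [0, 1, 2, 3, 4], []]

/-- A rotation system on six elements that is not twisted. -/
def seedD : Table :=
  [[1, 2, 5, 3, 4], [0, 2, 3, 5, 4], [0, 5, 3, 4, 1], [0, 4, 2, 1, 5], [0, 3, 2, 1, 5],
   [0, 2, 3, 1, 4], []]

/-- The six-tuples that are tested for being twisted. -/
def candidates : List (List ℕ) :=
  [[0, 1, 6, 2, 3, 4], [0, 1, 2, 3, 4, 6], [0, 1, 2, 3, 6, 4], [1, 0, 6, 3, 2, 5],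
   [0, 1, 2, 6, 3, 4], [1, 0, 3, 2, 5, 6], [1, 0, 3, 2, 6, 5], [4, 3, 2, 1, 0, 6],
   [0, 1, 2, 3, 4, 5], [0, 1, 2, 3, 5, 4], [0, 1, 2, 5, 3, 4], [0, 1, 5, 2, 3, 4],
   [0, 5, 1, 2, 3, 4], [0, 6, 1, 2, 3, 4], [1, 0, 3, 6, 2, 5], [1, 5, 0, 3, 2, 6],
   [1, 5, 0, 6, 3, 2], [1, 6, 0, 3, 2, 5], [3, 4, 0, 5, 1, 6], [4, 3, 2, 1, 0, 5],
   [5, 2, 3, 0, 1, 6], [0, 1, 5, 2, 6, 4], [0, 1, 5, 6, 2, 4], [0, 1, 6, 5, 2, 4],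
   [0, 3, 2, 5, 4, 6], [0, 3, 2, 5, 6, 4], [0, 5, 6, 2, 3, 4], [0, 6, 3, 2, 5, 4],
   [0, 6, 5, 2, 3, 4], [1, 0, 4, 3, 6, 5], [1, 0, 4, 6, 3, 5], [1, 0, 6, 4, 3, 5],
   [1, 2, 3, 4, 5, 6], [1, 2, 3, 4, 6, 5], [1, 5, 0, 3, 6, 2], [1, 5, 0, 4, 3, 6],
   [1, 5, 0, 4, 6, 3], [1, 5, 0, 6, 4, 3], [1, 5, 6, 0, 3, 2], [1, 6, 2, 3, 4, 5],
   [1, 6, 5, 0, 3, 2], [4, 3, 2, 1, 5, 6], [4, 3, 2, 1, 6, 5], [4, 3, 2, 5, 0, 6],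
   [4, 3, 2, 6, 1, 5], [4, 5, 2, 3, 0, 6], [5, 1, 2, 3, 4, 6], [5, 4, 3, 2, 1, 6]]

/-- The renamed rotation systems that are tested for being realized. -/
def renamings : List (Table × List ℕ) :=
  [(seedA, [0, 1, 2, 3, 4, 5]), (seedA, [0, 5, 1, 2, 3, 4]), (seedA, [1, 0, 3, 2, 5, 4]),
   (seedA, [1, 0, 3, 5, 2, 4]), (seedA, [1, 0, 5, 3, 2, 4]), (seedA, [3, 4, 1, 2, 5, 0]),
   (seedA, [3, 4, 1, 5, 2, 0]), (seedA, [3, 4, 5, 1, 2, 0]), (seedA, [4, 3, 2, 1, 0, 5]),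
   (seedA, [4, 5, 3, 2, 1, 0]), (seedA, [5, 0, 1, 2, 3, 4]), (seedA, [5, 4, 3, 2, 1, 0]),
   (seedB, [0, 1, 2, 3, 4, 5]), (seedB, [0, 1, 3, 5, 4, 2]), (seedB, [0, 1, 5, 3, 4, 2]),
   (seedB, [0, 5, 2, 1, 4, 3]), (seedB, [1, 0, 3, 2, 5, 4]), (seedB, [3, 4, 1, 2, 5, 0]),
   (seedB, [4, 3, 1, 5, 0, 2]), (seedB, [4, 3, 2, 1, 0, 5]), (seedB, [4, 3, 5, 1, 0, 2]),
   (seedB, [4, 5, 2, 3, 0, 1]), (seedB, [5, 0, 2, 1, 4, 3]), (seedB, [5, 4, 2, 3, 0, 1]),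
   (seedC, [0, 1, 2, 3, 4, 5]), (seedC, [0, 5, 2, 3, 4, 1]), (seedC, [2, 0, 4, 3, 5, 1]),
   (seedC, [2, 0, 4, 5, 3, 1]), (seedC, [2, 0, 5, 4, 3, 1]), (seedC, [2, 4, 0, 1, 5, 3]),
   (seedC, [2, 4, 0, 5, 1, 3]), (seedC, [2, 4, 5, 0, 1, 3]), (seedC, [4, 3, 2, 1, 0, 5]),
   (seedC, [4, 5, 2, 1, 0, 3]), (seedC, [5, 1, 2, 3, 4, 0]), (seedC, [5, 3, 2, 1, 0, 4]),
   (seedD, [0, 1, 2, 3, 4, 5]), (seedD, [0, 2, 1, 5, 3, 4]), (seedD, [1, 4, 0, 3, 5, 2]),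
   (seedD, [2, 5, 0, 4, 3, 1])]

/-- The empty table. -/
def emptyTable : Table :=
  List.replicate 7 []

/-- The steps that construct the rotation systems on six elements. -/
def sixSteps : List Step :=
  edgeSteps 20 18 1 [] [0] ++ edgeSteps 20 18 2 [] [0, 1] ++ edgeSteps 20 18 3 [] [0, 1, 2] ++
    edgeSteps 20 18 4 [] [0, 1, 2, 3] ++ edgeSteps 23 23 5 [] [0, 1, 2, 3, 4]

/-- The steps that extend a rotation system on six elements to seven elements. -/
def sevenSteps : List Step :=
  edgeSteps 23 23 6 [] [0, 1, 2, 3, 4, 5]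

set_option maxRecDepth 10000 in
theorem search_sixSteps :
    search (fun S => candidates.any (isTwisted S) ||
      renamings.any fun p => isRenaming S p.1 (imageOf p.2)) sixSteps emptyTable = true := by
  decide +kernel

set_option maxRecDepth 10000 in
theorem search_seedA :
    search (fun S => candidates.any (isTwisted S)) sevenSteps seedA = true := by
  decide +kernel

set_option maxRecDepth 10000 in
theorem search_seedB :
    search (fun S => candidates.any (isTwisted S)) sevenSteps seedB = true := by
  decide +kernel

set_option maxRecDepth 10000 in
theorem search_seedC :
    search (fun S => candidates.any (isTwisted S)) sevenSteps seedC = true := by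
  decide +kernel

set_option maxRecDepth 10000 in
theorem search_seedD :
    search (fun S => candidates.any (isTwisted S)) sevenSteps seedD = true := by
  decide +kernel

theorem search_sevenSteps :
    ∀ p ∈ renamings, search (fun S => candidates.any (isTwisted S)) sevenSteps p.1 = true := by
  have hmem : ∀ p ∈ renamings, p.1 ∈ [seedA, seedB, seedC, seedD] := by
    decide +kernel
  intro p hp
  have h := hmem p hp
  simp only [List.mem_cons, List.not_mem_nil, or_false] at h
  rcases h with h | h | h | h <;> rw [h]
  exacts [search_seedA, search_seedB, search_seedC, search_seedD]

theorem valid_sixSteps : ∀ s ∈ sixSteps, s.Valid := by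
  decide +kernel

theorem valid_sevenSteps : ∀ s ∈ sevenSteps, s.Valid ∧ s.types = 23 := by
  decide +kernel

theorem valid_candidates : ∀ w ∈ candidates, w.length = 6 ∧ w.Nodup ∧ ∀ x ∈ w, x < 7 := by
  decide +kernel

theorem valid_renamings : ∀ p ∈ renamings, Table.Valid p.1 ∧
    (∀ x < 7, imageOf p.2 x < 7) ∧ ∀ x < 7, ∀ y < 7, imageOf p.2 x = imageOf p.2 y → x = y := by
  decide +kernel

end Certificate

section Main

variable {P : PreRotSys (Fin 7)} {u : ℕ → Fin 7} {S : Table}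

theorem Realizes.containsT_six (hP : GenTwisted P) (hu : Set.InjOn u (Set.Iio 7))
    (hS : P.Realizes u S) (h : candidates.any (isTwisted S) = true) : ContainsT P 6 := by
  obtain ⟨w, hw, h⟩ := List.any_eq_true.1 h
  obtain ⟨hlen, hnodup, hlt⟩ := valid_candidates w hw
  exact hlen ▸ hS.containsT hP hu hnodup hlt h

theorem containsT_of_twisted (hP : GenTwisted P) (hu : Set.InjOn u (Set.Iio 7))
    (h : ∀ a b c d, a < b → b < c → c < d → d < 5 → Crosses P (u a) (u b) (u d) (u c)) :
    ContainsT P 6 := by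
  have hempty : P.Realizes u emptyTable :=
    Table.Valid.realizes (by decide) fun v hv => by interval_cases v <;> trivial
  obtain ⟨S, hS, hfin⟩ := hempty.exists_of_search hu
    (fun s hs => (valid_sixSteps s hs).stepSound hP hu (.inr h)) search_sixSteps
  rcases (Bool.or_eq_true _ _).mp hfin with hfin | hfin
  · exact hS.containsT_six hP hu hfin
  · obtain ⟨p, hp, hrel⟩ := List.any_eq_true.1 hfin
    obtain ⟨hT, hmaps, hinj⟩ := valid_renamings p hp
    have hu' : Set.InjOn (u ∘ imageOf p.2) (Set.Iio 7) :=
      hu.comp (fun x hx y hy => hinj x hx y hy) fun x hx => hmaps x hx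
    obtain ⟨S', hS', hfin'⟩ := (hS.of_isRenaming hT hrel).exists_of_search hu'
      (fun s hs => (valid_sevenSteps s hs).1.stepSound hP hu' (.inl (valid_sevenSteps s hs).2))
      (search_sevenSteps p hp)
    exact hS'.containsT_six hP hu' hfin'

end Main

end PreRotSys

/-- Every generalized twisted pre-rotation system on 7 elements contains
the perfect twisted configuration `T_6`; in particular `N_gt(T_6) ≤ 7`. -/
theorem gen_twisted_seven_contains_T6
    (P : PreRotSys (Fin 7)) (hP : GenTwisted P) :
    ContainsT P 6 := by
  obtain ⟨e, he⟩ := hP.2 (Fin.castLE (by decide)) (Fin.castLE_injective _)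
  let u : ℕ → Fin 7 := fun n =>
    if h : n < 5 then Fin.castLE (by decide) (e ⟨n, h⟩) else Fin.ofNat 7 n
  have hu : Set.InjOn u (Set.Iio 7) := by
    intro x hx y hy hxy
    simp only [Set.mem_Iio] at hx hy
    simp only [u, Fin.ext_iff] at hxy
    split_ifs at hxy with h₁ h₂ h₂
    · exact Fin.mk.inj (e.injective (Fin.ext hxy))
    · have := (e ⟨x, h₁⟩).isLt
      simp only [Fin.val_castLE, Fin.val_ofNat, Nat.mod_eq_of_lt hy] at hxy
      omega
    · have := (e ⟨y, h₂⟩).isLt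
      simp only [Fin.val_castLE, Fin.val_ofNat, Nat.mod_eq_of_lt hx] at hxy
      omega
    · simpa only [Fin.val_ofNat, Nat.mod_eq_of_lt hx, Nat.mod_eq_of_lt hy] using hxy
  refine PreRotSys.containsT_of_twisted hP hu fun a b c d hab hbc hcd hd => ?_
  have hc := hcd.trans hd
  have hb := hbc.trans hc
  have ha := hab.trans hb
  simpa only [u, ha, hb, hc, hd, dif_pos] using
    (he ⟨a, ha⟩ ⟨b, hb⟩ ⟨c, hc⟩ ⟨d, hd⟩ hab hbc hcd).1
end

section
/- There exists a generalized twisted pre-rotation system on 9 elements that does not contain T_7. (Together with the upper bound, this shows N_gt(T_7) = 10.) -/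
section NineVertexExample

/-- The `i`-th neighbour in the rotation of `v`, with `i` read modulo `8`. -/
def rotationEntry (v : Fin 9) (i : ℕ) : Fin 9 :=
  (![![1, 2, 3, 4, 5, 6, 7, 8],
    ![0, 2, 3, 4, 5, 6, 7, 8],
    ![0, 3, 4, 5, 6, 7, 8, 1],
    ![0, 8, 7, 6, 4, 5, 2, 1],
    ![0, 8, 7, 6, 5, 3, 2, 1],
    ![0, 8, 7, 6, 4, 3, 2, 1],
    ![0, 7, 8, 3, 4, 5, 2, 1],
    ![0, 8, 3, 4, 5, 6, 2, 1],
    ![0, 3, 4, 5, 7, 6, 2, 1]] : Fin 9 → Fin 8 → Fin 9) v (Fin.ofNat 8 i)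

/-- The index of `x` in the rotation of `v`, stored as a decimal digit of the `v`-th number;
the meaningless digit for `x = v` is `8`. -/
def rotationIndex (v x : Fin 9) : ℕ :=
  (![765432108,
    765432180,
    654321870,
    123548670,
    123485670,
    123845670,
    218543670,
    185432670,
    845321670] : Fin 9 → ℕ) v / 10 ^ x.val % 10

theorem rotationEntry_congr (v : Fin 9) {i j : ℕ} (h : i % 8 = j % 8) :
    rotationEntry v i = rotationEntry v j := by
  have : Fin.ofNat 8 i = Fin.ofNat 8 j := Fin.ext h
  simp only [rotationEntry, this]

theorem rotationEntry_rotationIndex {v x : Fin 9} (h : x ≠ v) :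
    rotationEntry v (rotationIndex v x) = x := by
  revert v x
  decide +kernel

theorem rotationIndex_lt {v x : Fin 9} (h : x ≠ v) : rotationIndex v x < 8 := by
  revert v x
  decide +kernel

theorem rotationEntry_ne (v : Fin 9) (i : ℕ) : rotationEntry v i ≠ v := by
  have key : ∀ v : Fin 9, ∀ j < 8, rotationEntry v j ≠ v := by decide +kernel
  rw [rotationEntry_congr v (Nat.mod_mod i 8).symm]
  exact key v _ (Nat.mod_lt _ (by norm_num))

theorem rotationIndex_rotationEntry (v : Fin 9) (i : ℕ) :
    rotationIndex v (rotationEntry v i) = i % 8 := by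
  have key : ∀ v : Fin 9, ∀ j < 8, rotationIndex v (rotationEntry v j) = j := by decide +kernel
  rw [rotationEntry_congr v (Nat.mod_mod i 8).symm]
  exact key v _ (Nat.mod_lt _ (by norm_num))

/-- Move `x` forward by `k` steps in the rotation of `v`, fixing `v`. -/
def rotationShift (v : Fin 9) (k : ℕ) (x : Fin 9) : Fin 9 :=
  if x = v then v else rotationEntry v (rotationIndex v x + k)

theorem rotationShift_rotationShift {v : Fin 9} {k l : ℕ} (h : (k + l) % 8 = 0) (x : Fin 9) :
    rotationShift v l (rotationShift v k x) = x := by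
  by_cases hx : x = v
  · simp [rotationShift, hx]
  · simp only [rotationShift, hx, if_false, rotationEntry_ne, rotationIndex_rotationEntry]
    conv_rhs => rw [← rotationEntry_rotationIndex hx]
    exact rotationEntry_congr v (by omega)

/-- The cyclic permutation assigned to `v`. -/
def nineRotation (v : Fin 9) : Equiv.Perm (Fin 9) where
  toFun := rotationShift v 1
  invFun := rotationShift v 7
  left_inv := rotationShift_rotationShift rfl
  right_inv := rotationShift_rotationShift rfl

theorem nineRotation_iterate {v b : Fin 9} (hb : b ≠ v) (i : ℕ) :
    (⇑(nineRotation v))^[i] b = rotationEntry v (rotationIndex v b + i) := by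
  induction i with
  | zero => exact (rotationEntry_rotationIndex hb).symm
  | succ i ih =>
    rw [Function.iterate_succ_apply', ih]
    change rotationShift v 1 _ = _
    rw [rotationShift, if_neg (rotationEntry_ne _ _), rotationIndex_rotationEntry]
    exact rotationEntry_congr v (by omega)

theorem isCyclicPermOn_nineRotation (v : Fin 9) :
    IsCyclicPermOn (nineRotation v) (Finset.univ.erase v) := by
  refine ⟨fun a ha => ?_, fun a ha b hb => ?_⟩
  · obtain rfl : a = v := by simpa using ha
    exact if_pos rfl
  · replace ha := Finset.ne_of_mem_erase ha
    replace hb := Finset.ne_of_mem_erase hb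
    refine ⟨rotationIndex v b + 8 - rotationIndex v a, ?_⟩
    rw [nineRotation_iterate ha]
    conv_rhs => rw [← rotationEntry_rotationIndex hb]
    have := rotationIndex_lt ha
    exact rotationEntry_congr v (by omega)

/-- A generalized twisted pre-rotation system on nine elements without `T_7`. -/
def nineSystem : PreRotSys (Fin 9) where
  rot := nineRotation
  cyc := isCyclicPermOn_nineRotation

/-- Boolean version of `rotOrd` for `nineSystem`, valid when `b`, `c`, `d` differ from `v`. -/
def nineOrd (v b c d : Fin 9) : Bool :=
  let i := (rotationIndex v c + 8 - rotationIndex v b) % 8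
  Nat.blt 0 i && Nat.blt i ((rotationIndex v d + 8 - rotationIndex v b) % 8)

theorem rotOrd_nineSystem_iff {v b c d : Fin 9} (hb : b ≠ v) (hc : c ≠ v) (hd : d ≠ v) :
    rotOrd nineSystem v b c d ↔ nineOrd v b c d = true := by
  have hbl := rotationIndex_lt hb
  have hcl := rotationIndex_lt hc
  have hdl := rotationIndex_lt hd
  have hcard : (Finset.univ.erase v : Finset (Fin 9)).card = 8 := by simp
  simp only [rotOrd, CycOrd, nineSystem, nineRotation_iterate hb, hcard, nineOrd,
    Bool.and_eq_true, Nat.blt_eq]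
  constructor
  · rintro ⟨i, j, hi, hij, hj, rfl, rfl⟩
    rw [rotationIndex_rotationEntry, rotationIndex_rotationEntry]
    omega
  · rintro ⟨hi, hij⟩
    refine ⟨_, _, hi, hij, Nat.mod_lt _ (by norm_num), ?_, ?_⟩
    · conv_rhs => rw [← rotationEntry_rotationIndex hc]
      exact rotationEntry_congr v (by omega)
    · conv_rhs => rw [← rotationEntry_rotationIndex hd]
      exact rotationEntry_congr v (by omega)

/-- Boolean version of the distinctness condition in `Crosses`. -/
def distinctQuad (p q r s : Fin 9) : Bool :=
  p != q && p != r && p != s && q != r && q != s && r != s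

/-- Boolean version of `Crosses` for `nineSystem`. -/
def nineCrosses (p q r s : Fin 9) : Bool :=
  distinctQuad p q r s &&
    (nineOrd p q r s && nineOrd q p r s && nineOrd r p q s && nineOrd s p q r ||
      nineOrd p q s r && nineOrd q p s r && nineOrd r p s q && nineOrd s p r q)

theorem crosses_nineSystem_iff (p q r s : Fin 9) :
    Crosses nineSystem p q r s ↔ nineCrosses p q r s = true := by
  simp only [Crosses, nineCrosses, distinctQuad, Bool.and_eq_true, Bool.or_eq_true, bne_iff_ne,
    and_assoc]
  constructor
  · rintro ⟨hpq, hpr, hps, hqr, hqs, hrs, h⟩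
    refine ⟨hpq, hpr, hps, hqr, hqs, hrs, ?_⟩
    simpa only [rotOrd_nineSystem_iff, ne_eq, hpq, hpr, hps, hqr, hqs, hrs, hpq.symm, hpr.symm,
      hps.symm, hqr.symm, hqs.symm, hrs.symm, not_false_eq_true] using h
  · rintro ⟨hpq, hpr, hps, hqr, hqs, hrs, h⟩
    refine ⟨hpq, hpr, hps, hqr, hqs, hrs, ?_⟩
    simpa only [rotOrd_nineSystem_iff, ne_eq, hpq, hpr, hps, hqr, hqs, hrs, hpq.symm, hpr.symm,
      hps.symm, hqr.symm, hqs.symm, hrs.symm, not_false_eq_true] using h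

/-- The quadruple condition in `TwistedTuple`, as a Boolean for `nineSystem`. -/
def twistedQuad (a b c d : Fin 9) : Bool :=
  nineCrosses a b d c && !nineCrosses a c b d && !nineCrosses a b c d

theorem twistedTuple_nineSystem_iff {k : ℕ} (u : Fin k → Fin 9) :
    TwistedTuple nineSystem u ↔ ∀ a b c d : Fin k, a < b → b < c → c < d →
      twistedQuad (u a) (u b) (u c) (u d) = true := by
  simp only [TwistedTuple, crosses_nineSystem_iff, twistedQuad, Bool.and_eq_true,
    Bool.not_eq_true', Bool.not_eq_true, and_assoc]

theorem ne_of_twistedQuad {a b c d : Fin 9} (h : twistedQuad a b c d = true) :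
    a ≠ b ∧ a ≠ c ∧ a ≠ d ∧ b ≠ c ∧ b ≠ d ∧ c ≠ d := by
  simp only [twistedQuad, nineCrosses, distinctQuad, Bool.and_eq_true, bne_iff_ne, and_assoc] at h
  tauto

theorem pi4Free_nineSystem : Pi4Free nineSystem := by
  have key : ∀ a b c d : Fin 9, distinctQuad a b c d = true →
      (nineOrd a b c d && nineOrd b a c d && nineOrd c a b d && nineOrd d a c b) = false ∧
      (nineOrd a b d c && nineOrd b a d c && nineOrd c a d b && nineOrd d a b c) = false := by
    decide +kernel
  intro a b c d hab hac had hbc hbd hcd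
  have h := key a b c d (by simp [distinctQuad, hab, hac, had, hbc, hbd, hcd])
  simp only [← Bool.not_eq_true, Bool.and_eq_true, and_assoc] at h
  simpa only [rotOrd_nineSystem_iff, ne_eq, hab, hac, had, hbc, hbd, hcd, hab.symm, hac.symm,
    had.symm, hbc.symm, hbd.symm, hcd.symm, not_false_eq_true] using h

theorem exists_twisted_labelling : ∀ a b : Fin 9, a < b → ∀ c, b < c → ∀ d, c < d → ∀ e, d < e →
    ([a, b, c, d, e].any fun x => [a, b, c, d, e].any fun y => [a, b, c, d, e].any fun z =>
      [a, b, c, d, e].any fun t => twistedQuad x y z t && [a, b, c, d, e].any fun s =>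
        twistedQuad x y z s && twistedQuad x y t s && twistedQuad x z t s &&
          twistedQuad y z t s) = true := by
  decide +kernel

theorem not_twisted_seven : ∀ a b c d : Fin 9, twistedQuad a b c d = true →
    ∀ e, (twistedQuad a b c e && twistedQuad a b d e && twistedQuad a c d e &&
        twistedQuad b c d e) = true →
    ∀ f, (twistedQuad a b c f && twistedQuad a b d f && twistedQuad a b e f &&
        twistedQuad a c d f && twistedQuad a c e f && twistedQuad a d e f &&
        twistedQuad b c d f && twistedQuad b c e f && twistedQuad b d e f &&
        twistedQuad c d e f) = true →
    ∀ g, (twistedQuad a b c g && twistedQuad a b d g && twistedQuad a b e g &&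
        twistedQuad a b f g && twistedQuad a c d g && twistedQuad a c e g &&
        twistedQuad a c f g && twistedQuad a d e g && twistedQuad a d f g &&
        twistedQuad a e f g && twistedQuad b c d g && twistedQuad b c e g &&
        twistedQuad b c f g && twistedQuad b d e g && twistedQuad b d f g &&
        twistedQuad b e f g && twistedQuad c d e g && twistedQuad c d f g &&
        twistedQuad c e f g && twistedQuad d e f g) = false := by
  decide +kernel

theorem exists_twistedTuple_five (w : Fin 5 → Fin 9) (hw : Function.Injective w) :
    ∃ e : Equiv.Perm (Fin 5), TwistedTuple nineSystem (fun x => w (e x)) := by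
  have hcard : (Finset.univ.image w).card = 5 := by simp [Finset.card_image_of_injective _ hw]
  obtain ⟨o, hmono, hrange⟩ : ∃ o : Fin 5 → Fin 9, StrictMono o ∧ ∀ i, o i ∈ Set.range w :=
    ⟨(Finset.univ.image w).orderEmbOfFin hcard, OrderEmbedding.strictMono _, fun i => by
      have := Finset.orderEmbOfFin_mem (Finset.univ.image w) hcard i
      rwa [← Finset.mem_coe, Finset.coe_image, Finset.coe_univ, Set.image_univ] at this⟩
  have ho (i j : Fin 5) (h : i < j) : o i < o j := hmono h
  have hmem (x : Fin 9) (hx : x ∈ [o 0, o 1, o 2, o 3, o 4]) : x ∈ Set.range w := by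
    simp only [List.mem_cons, List.not_mem_nil, or_false] at hx
    rcases hx with rfl | rfl | rfl | rfl | rfl <;> exact hrange _
  have hlabel :=
    exists_twisted_labelling (o 0) (o 1) (ho _ _ (by decide)) (o 2) (ho _ _ (by decide))
      (o 3) (ho _ _ (by decide)) (o 4) (ho _ _ (by decide))
  simp only [List.any_eq_true, Bool.and_eq_true, and_assoc] at hlabel
  obtain ⟨x, hx, y, hy, z, hz, t, ht, hxyzt, s, hs, hxyzs, hxyts, hxzts, hyzts⟩ := hlabel
  obtain ⟨i, rfl⟩ := hmem x hx
  obtain ⟨j, rfl⟩ := hmem y hy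
  obtain ⟨k, rfl⟩ := hmem z hz
  obtain ⟨l, rfl⟩ := hmem t ht
  obtain ⟨m, rfl⟩ := hmem s hs
  have hinj : Function.Injective ![i, j, k, l, m] := by
    have h1 := ne_of_twistedQuad hxyzt
    have h2 := ne_of_twistedQuad hxyzs
    have h3 := ne_of_twistedQuad hxyts
    simp only [hw.ne_iff] at h1 h2 h3
    rw [← List.nodup_ofFn]
    simp [List.ofFn_succ]
    tauto
  refine ⟨Equiv.ofBijective _ (Finite.injective_iff_bijective.mp hinj), ?_⟩
  rw [twistedTuple_nineSystem_iff]
  have hquads : ∀ a b c d : Fin 5, a < b → b < c → c < d →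
      (a, b, c, d) ∈ [(0, 1, 2, 3), (0, 1, 2, 4), (0, 1, 3, 4), (0, 2, 3, 4), (1, 2, 3, 4)] := by
    decide +kernel
  intro a b c d hab hbc hcd
  have := hquads a b c d hab hbc hcd
  simp only [List.mem_cons, List.not_mem_nil, or_false, Prod.mk.injEq] at this
  rcases this with ⟨rfl, rfl, rfl, rfl⟩ | ⟨rfl, rfl, rfl, rfl⟩ | ⟨rfl, rfl, rfl, rfl⟩ |
    ⟨rfl, rfl, rfl, rfl⟩ | ⟨rfl, rfl, rfl, rfl⟩ <;> assumption

theorem not_containsT_seven_nineSystem : ¬ ContainsT nineSystem 7 := by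
  rintro ⟨u, -, h⟩
  rw [twistedTuple_nineSystem_iff] at h
  have hq (a b c d : Fin 7) (hlt : a < b ∧ b < c ∧ c < d) :
      twistedQuad (u a) (u b) (u c) (u d) = true := h a b c d hlt.1 hlt.2.1 hlt.2.2
  have := not_twisted_seven (u 0) (u 1) (u 2) (u 3) (hq _ _ _ _ (by decide))
    (u 4) (by simp [hq]) (u 5) (by simp [hq]) (u 6)
  simp [hq] at this

end NineVertexExample

/-- There exists a generalized twisted pre-rotation system on 9 elements
that does not contain the perfect twisted configuration `T_7`. -/
theorem gen_twisted_nine_without_T7 :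
    ∃ P : PreRotSys (Fin 9), GenTwisted P ∧ ¬ ContainsT P 7 :=
  ⟨nineSystem, ⟨pi4Free_nineSystem, exists_twistedTuple_five⟩, not_containsT_seven_nineSystem⟩
end

section
/- There exists a generalized twisted pre-rotation system on 12 elements that does not contain T_8. (In particular N_gt(T_8) > 12.) -/
section CyclicOrder

variable {α : Type*} [DecidableEq α]

theorem List.Nodup.formPerm_iterate_getElem {l : List α} (hl : l.Nodup) (k i : ℕ)
    (hi : i < l.length) :
    (⇑l.formPerm)^[k] l[i] =
      l[(i + k) % l.length]'(Nat.mod_lt _ (Nat.zero_lt_of_lt hi)) := by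
  rw [← Equiv.Perm.coe_pow, List.formPerm_pow_apply_getElem l hl k i hi]

theorem isCyclicPermOn_formPerm {l : List α} (hl : l.Nodup) {S : Finset α}
    (hS : ∀ x, x ∈ S ↔ x ∈ l) : IsCyclicPermOn l.formPerm S := by
  refine ⟨fun a ha => List.formPerm_apply_of_notMem fun h => ha ((hS a).2 h), ?_⟩
  intro a ha b hb
  obtain ⟨i, hi, rfl⟩ := List.getElem_of_mem ((hS a).1 ha)
  obtain ⟨j, hj, rfl⟩ := List.getElem_of_mem ((hS b).1 hb)
  refine ⟨j + (l.length - i), ?_⟩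
  rw [hl.formPerm_iterate_getElem, hl.getElem_inj_iff]
  rw [show i + (j + (l.length - i)) = j + l.length by omega, Nat.add_mod_right,
    Nat.mod_eq_of_lt hj]

/-- The positions `i, j, k` are pairwise distinct and are met in this cyclic order. -/
def cycLt (i j k : ℕ) : Bool :=
  cond (Nat.blt i j) (Nat.blt j k || Nat.blt k i) (Nat.blt j k && Nat.blt k i)

theorem cycLt_iff {i j k : ℕ} :
    cycLt i j k = true ↔ i < j ∧ j < k ∨ j < k ∧ k < i ∨ k < i ∧ i < j := by
  unfold cycLt
  by_cases h : i < j
  · simp [Nat.blt_eq, h]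
    omega
  · simp [Nat.blt_eq, h]

theorem cycOrd_formPerm_iff {l : List α} (hl : l.Nodup) {S : Finset α}
    (hS : S.card = l.length) {i j k : ℕ} (hi : i < l.length) (hj : j < l.length)
    (hk : k < l.length) :
    CycOrd l.formPerm S l[i] l[j] l[k] ↔ cycLt i j k = true := by
  have mod_cases : ∀ s, s < l.length →
      (i + s) % l.length = if i + s < l.length then i + s else i + s - l.length := by
    intro s hs
    split_ifs with h
    · exact Nat.mod_eq_of_lt h
    · rw [Nat.mod_eq_sub_mod (by omega), Nat.mod_eq_of_lt (by omega)]
  simp only [CycOrd, hl.formPerm_iterate_getElem, hl.getElem_inj_iff, hS, cycLt_iff]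
  constructor
  · rintro ⟨s, t, hs, hst, ht, h₁, h₂⟩
    rw [mod_cases s (by omega)] at h₁
    rw [mod_cases t ht] at h₂
    split_ifs at h₁ h₂ <;> omega
  · intro h
    refine ⟨if i < j then j - i else j + l.length - i,
      if i < k then k - i else k + l.length - i, ?_⟩
    rw [mod_cases _ (by split_ifs <;> omega), mod_cases _ (by split_ifs <;> omega)]
    grind

end CyclicOrder

section QuadrupleSearch

variable {α : Type*} (p : α → α → α → α → Bool)

/-- Every quadruple of entries of `l`, read from right to left, satisfies `p`. -/
def AllQuadruples (l : List α) : Prop :=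
  ∀ a b c d, [d, c, b, a].Sublist l → p a b c d = true

/-- `p a b c x` holds for all entries `b`, `a` occurring in this order in the list. -/
def pairsCompatible (x c : α) : List α → Bool
  | [] => true
  | b :: t => t.all (fun a => p a b c x) && pairsCompatible x c t

/-- `p a b c x` holds for all entries `c`, `b`, `a` occurring in this order in the list. -/
def triplesCompatible (x : α) : List α → Bool
  | [] => true
  | c :: t => pairsCompatible p x c t && triplesCompatible x t

theorem pairsCompatible_iff {x c : α} {t : List α} :
    pairsCompatible p x c t = true ↔ ∀ b a, [b, a].Sublist t → p a b c x = true := by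
  have h : pairsCompatible p x c t = true ↔ t.Pairwise fun b a => p a b c x = true := by
    induction t with
    | nil => simp [pairsCompatible]
    | cons b t ih => simp [pairsCompatible, ih]
  rw [h, List.pairwise_iff_forall_sublist]

theorem triplesCompatible_iff {x : α} {t : List α} :
    triplesCompatible p x t = true ↔
      ∀ c b a, [c, b, a].Sublist t → p a b c x = true := by
  induction t with
  | nil => simp [triplesCompatible]
  | cons c t ih =>
    simp only [triplesCompatible, Bool.and_eq_true, pairsCompatible_iff, ih]
    constructor
    · rintro ⟨h₁, h₂⟩ c' b a h
      cases h with
      | cons _ h => exact h₂ _ _ _ h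
      | cons_cons _ h => exact h₁ _ _ h
    · exact fun h => ⟨fun b a hs => h _ _ _ (hs.cons_cons _), fun _ _ _ hs => h _ _ _ (hs.cons _)⟩

theorem allQuadruples_cons {x : α} {t : List α} :
    AllQuadruples p (x :: t) ↔ triplesCompatible p x t = true ∧ AllQuadruples p t := by
  rw [triplesCompatible_iff]
  constructor
  · exact fun h => ⟨fun c b a hs => h _ _ _ _ (hs.cons_cons _),
      fun _ _ _ _ hs => h _ _ _ _ (hs.cons _)⟩
  · rintro ⟨h₁, h₂⟩ a b c d h
    cases h with
    | cons _ h => exact h₂ _ _ _ _ h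
    | cons_cons _ h => exact h₁ _ _ _ h

theorem AllQuadruples.of_append {s t : List α} (h : AllQuadruples p (s ++ t)) :
    AllQuadruples p t :=
  fun _ _ _ _ hs => h _ _ _ _ (hs.trans (List.sublist_append_right s t))

theorem allQuadruples_ofFn_reverse {n : ℕ} {u : Fin n → α} :
    AllQuadruples p (List.ofFn u).reverse ↔
      ∀ a b c d, a < b → b < c → c < d → p (u a) (u b) (u c) (u d) = true := by
  have key : ∀ a b c d, [d, c, b, a].Sublist (List.ofFn u).reverse ↔
      [a, b, c, d].Sublist ((List.finRange n).map u) := by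
    intro a b c d
    rw [← List.reverse_sublist, List.reverse_reverse, List.ofFn_eq_map]
    rfl
  simp only [AllQuadruples, key]
  constructor
  · intro h a b c d hab hbc hcd
    refine h _ _ _ _ (List.Sublist.map u (l₁ := [a, b, c, d]) ?_)
    refine List.sublist_of_subperm_of_pairwise (r := (· ≤ ·))
      (List.subperm_of_subset ?_ (by simp)) ?_ (List.pairwise_le_finRange n)
    · simp; omega
    · simp; omega
  · intro h a b c d hs
    obtain ⟨l, hl, he⟩ := List.sublist_map_iff.1 hs
    have hp := (List.pairwise_lt_finRange n).sublist hl
    obtain ⟨a', b', c', d', rfl⟩ : ∃ a' b' c' d', l = [a', b', c', d'] := by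
      have := congrArg List.length he
      simp only [List.length_map, List.length_cons, List.length_nil] at this
      exact List.length_eq_four.1 this.symm
    simp only [List.map_cons, List.map_nil, List.cons.injEq, and_true] at he
    obtain ⟨rfl, rfl, rfl, rfl⟩ := he
    simp at hp
    exact h _ _ _ _ hp.1.1 hp.2.1.1 hp.2.2

variable [DecidableEq α]

/-- Backtracking search for `n` further entries, taken from `avail` without repetition, that
can be put in front of `t` so that all quadruples still satisfy `p`. -/
def canExtend : ℕ → List α → List α → Bool
  | 0, _, _ => true
  | n + 1, avail, t =>
    avail.any fun x => triplesCompatible p x t && canExtend n (avail.erase x) (x :: t)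

theorem canExtend_iff {n : ℕ} {avail t : List α} (ht : AllQuadruples p t) :
    canExtend p n avail t = true ↔
      ∃ s : List α, s.length = n ∧ s.Subperm avail ∧ AllQuadruples p (s ++ t) := by
  induction n generalizing avail t with
  | zero =>
    simp only [canExtend, true_iff]
    exact ⟨[], rfl, List.nil_subperm, ht⟩
  | succ n ih =>
    simp only [canExtend, List.any_eq_true, Bool.and_eq_true]
    constructor
    · rintro ⟨x, hx, hxt, h⟩
      obtain ⟨s, hs, hsub, hq⟩ := (ih ((allQuadruples_cons p).2 ⟨hxt, ht⟩)).1 h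
      refine ⟨s ++ [x], by simp [hs], ?_, by simpa using hq⟩
      exact (List.perm_append_singleton x s).subperm.trans
        (((List.subperm_cons x).2 hsub).trans (List.perm_cons_erase hx).symm.subperm)
    · rintro ⟨s, hs, hsub, hq⟩
      obtain ⟨s, x, rfl⟩ := s.eq_nil_or_concat'.resolve_left (by rintro rfl; simp at hs)
      rw [List.append_assoc, List.singleton_append] at hq
      have hx : x ∈ avail := hsub.subset (by simp)
      have hxt := hq.of_append
      refine ⟨x, hx, ((allQuadruples_cons p).1 hxt).1,
        (ih hxt).2 ⟨s, by simpa using hs, ?_, hq⟩⟩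
      rw [← List.subperm_cons x]
      exact (List.perm_append_singleton x s).symm.subperm.trans
        (hsub.trans (List.perm_cons_erase hx).subperm)

end QuadrupleSearch

theorem exists_perm_ofFn_comp {α : Type*} {n : ℕ} {w : Fin n → α} (hw : Function.Injective w)
    {l : List α} (h : l.Perm (List.ofFn w)) :
    ∃ e : Equiv.Perm (Fin n), List.ofFn (fun i => w (e i)) = l := by
  have hlen : l.length = n := by simpa using h.length_eq
  have hnd : l.Nodup := h.nodup_iff.2 (List.nodup_ofFn.2 hw)
  have hmem : ∀ i : Fin n, ∃ j, w j = l[i] := fun i =>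
    List.mem_ofFn.1 (h.subset (List.getElem_mem _))
  choose f hf using hmem
  have hinj : Function.Injective f := fun i j hij => by
    have := hf i
    rw [hij, hf j] at this
    exact Fin.ext (hnd.getElem_inj_iff.1 this.symm)
  refine ⟨Equiv.ofBijective f (Finite.injective_iff_bijective.1 hinj), ?_⟩
  apply List.ext_getElem
  · simp [hlen]
  · intro i h₁ h₂
    simp [hf]

/-- The vertices in the order in which they are met around each vertex. -/
def rotList : Fin 12 → List (Fin 12) := ![
  [1, 2, 3, 4, 5, 6, 7, 8, 9, 10, 11],
  [0, 2, 3, 4, 5, 6, 7, 8, 9, 10, 11],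
  [0, 1, 3, 4, 5, 6, 7, 8, 9, 10, 11],
  [0, 11, 1, 5, 4, 6, 7, 8, 9, 10, 2],
  [0, 11, 1, 5, 6, 7, 8, 9, 10, 3, 2],
  [0, 11, 1, 6, 7, 8, 9, 10, 3, 4, 2],
  [0, 11, 10, 9, 8, 1, 7, 5, 4, 3, 2],
  [0, 11, 10, 9, 8, 1, 6, 5, 4, 3, 2],
  [0, 11, 9, 10, 6, 7, 1, 5, 4, 3, 2],
  [0, 11, 10, 6, 7, 8, 1, 5, 4, 3, 2],
  [0, 11, 6, 7, 9, 8, 1, 5, 4, 3, 2],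
  [0, 3, 4, 5, 6, 7, 8, 9, 10, 1, 2]]

/-- The `x`-th pair of decimal digits of the `v`-th number, counted from the right, is the
position of `x` in `rotList v`; it is `11` if `x = v`. -/
def rotPos (v x : ℕ) : ℕ :=
  [
    100908070605040302010011,
    100908070605040302011100,
    100908070605040302110100,
    10908070605030411100200,
    10807060504031109100200,
    10706050403110908100200,
    10203040611070809100500,
    10203041106070809100500,
    10302110504070809100600,
    10211050403070809100600,
    11104050302070809100600,
    110807060504030201100900].getD v 0 / 100 ^ x % 100

theorem nodup_rotList : ∀ v, (rotList v).Nodup := by decide +kernel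

theorem mem_rotList : ∀ v x, x ∈ Finset.univ.erase v ↔ x ∈ rotList v := by decide +kernel

theorem length_rotList : ∀ v, (rotList v).length = 11 := by decide +kernel

theorem getElem?_rotPos : ∀ v x : Fin 12, x ≠ v → (rotList v)[rotPos v x]? = some x := by
  decide +kernel

/-- A generalized twisted system on twelve vertices without `T_8`. -/
def rotSys : PreRotSys (Fin 12) where
  rot v := (rotList v).formPerm
  cyc v := isCyclicPermOn_formPerm (nodup_rotList v) (mem_rotList v)

/-- Boolean form of `rotOrd rotSys`. -/
def ordB (v b c d : ℕ) : Bool :=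
  cycLt (rotPos v b) (rotPos v c) (rotPos v d)

theorem rotOrd_iff {v b c d : Fin 12} (hb : b ≠ v) (hc : c ≠ v) (hd : d ≠ v) :
    rotOrd rotSys v b c d ↔ ordB v b c d = true := by
  obtain ⟨hi, hi'⟩ := List.getElem?_eq_some_iff.1 (getElem?_rotPos v b hb)
  obtain ⟨hj, hj'⟩ := List.getElem?_eq_some_iff.1 (getElem?_rotPos v c hc)
  obtain ⟨hk, hk'⟩ := List.getElem?_eq_some_iff.1 (getElem?_rotPos v d hd)
  have := cycOrd_formPerm_iff (nodup_rotList v) (S := Finset.univ.erase v)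
    (by simp [length_rotList]) hi hj hk
  rwa [hi', hj', hk'] at this

/-- Boolean form of `Crosses rotSys` for four distinct vertices. -/
def crossB (p q r s : ℕ) : Bool :=
  (ordB p q r s && (ordB q p r s && (ordB r p q s && ordB s p q r))) ||
    (ordB p q s r && (ordB q p s r && (ordB r p s q && ordB s p r q)))

theorem crosses_iff {p q r s : Fin 12} (hpq : p ≠ q) (hpr : p ≠ r) (hps : p ≠ s)
    (hqr : q ≠ r) (hqs : q ≠ s) (hrs : r ≠ s) :
    Crosses rotSys p q r s ↔ crossB p q r s = true := by
  simp [Crosses, crossB, rotOrd_iff, hpq, hpr, hps, hqr, hqs, hrs, hpq.symm, hpr.symm,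
    hps.symm, hqr.symm, hqs.symm, hrs.symm]

/-- Among the edges spanned by `a, b, c, d`, exactly `{a, d}` and `{b, c}` cross. -/
def twistedB (a b c d : ℕ) : Bool :=
  crossB a b d c && (!crossB a c b d && !crossB a b c d)

theorem twistedTuple_iff {k : ℕ} {u : Fin k → Fin 12} (hu : Function.Injective u) :
    TwistedTuple rotSys u ↔
      AllQuadruples twistedB (List.ofFn fun i => (u i : ℕ)).reverse := by
  rw [allQuadruples_ofFn_reverse]
  refine forall₄_congr fun a b c d => forall₃_congr fun hab hbc hcd => ?_
  have ne : ∀ {i j}, i < j → u i ≠ u j := fun h => hu.ne h.ne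
  have h₁ := ne hab
  have h₂ := ne hbc
  have h₃ := ne hcd
  have h₄ := ne (hab.trans hbc)
  have h₅ := ne (hbc.trans hcd)
  have h₆ := ne (hab.trans (hbc.trans hcd))
  rw [crosses_iff h₁ h₆ h₄ h₅ h₂ h₃.symm, crosses_iff h₄ h₁ h₆ h₂.symm h₃ h₅,
    crosses_iff h₁ h₄ h₆ h₂ h₅ h₃]
  simp [twistedB]

/-- The labels of the vertices. -/
def labels : List ℕ := [0, 1, 2, 3, 4, 5, 6, 7, 8, 9, 10, 11]

theorem ofFn_subperm_labels {k : ℕ} {u : Fin k → Fin 12} (hu : Function.Injective u) :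
    (List.ofFn fun i => (u i : ℕ)).Subperm labels := by
  refine List.subperm_of_subset
    (List.nodup_ofFn.2 (Fin.val_injective.comp hu)) fun x hx => ?_
  obtain ⟨i, rfl⟩ := List.mem_ofFn.1 hx
  have := (u i).isLt
  simp only [labels, List.mem_cons, List.not_mem_nil]
  omega

theorem val_mem_labels (a : Fin 12) : (a : ℕ) ∈ labels := by
  revert a; decide

theorem labels_no_obstruction :
    (labels.all fun a => labels.all fun b => labels.all fun c => labels.all fun d =>
      !(ordB a b c d && (ordB b a c d && (ordB c a b d && ordB d a c b))) &&
      !(ordB a b d c && (ordB b a d c && (ordB c a d b && ordB d a b c)))) = true := by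
  decide +kernel

theorem pi4Free_rotSys : Pi4Free rotSys := by
  intro a b c d hab hac had hbc hbd hcd
  have h := labels_no_obstruction
  simp only [List.all_eq_true] at h
  have := h a (val_mem_labels a) b (val_mem_labels b) c (val_mem_labels c) d (val_mem_labels d)
  simpa [rotOrd_iff, hab, hac, had, hbc, hbd, hcd, hab.symm, hac.symm, had.symm, hbc.symm,
    hbd.symm, hcd.symm, ← Bool.not_eq_true, imp_iff_not_or] using this

theorem five_subsets_twisted :
    ((labels.sublistsLen 5).all fun s => canExtend twistedB 5 s []) = true := by
  decide +kernel

theorem no_eight_twisted : canExtend twistedB 8 labels [] = false := by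
  decide +kernel

theorem allQuadruples_nil : AllQuadruples twistedB [] := by
  intro a b c d h
  simp at h

theorem genTwisted_rotSys : GenTwisted rotSys := by
  refine ⟨pi4Free_rotSys, fun w hw => ?_⟩
  obtain ⟨s, hs, hsub⟩ := ofFn_subperm_labels hw
  have hlen : s.length = 5 := by simpa using hs.length_eq
  have h := List.all_eq_true.1 five_subsets_twisted s (List.mem_sublistsLen.2 ⟨hsub, hlen⟩)
  obtain ⟨l, hl, hls, hq⟩ := (canExtend_iff _ allQuadruples_nil).1 h
  have hperm : l.reverse.Perm (List.ofFn fun i => (w i : ℕ)) :=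
    l.reverse_perm.trans ((hls.perm_of_length_le (by omega)).trans hs)
  obtain ⟨e, he⟩ := exists_perm_ofFn_comp (Fin.val_injective.comp hw) hperm
  refine ⟨e, (twistedTuple_iff (hw.comp e.injective)).2 ?_⟩
  simp only [Function.comp_apply] at he ⊢
  rw [he]
  simpa using hq

theorem not_containsT_rotSys : ¬ ContainsT rotSys 8 := by
  rintro ⟨u, hu, ht⟩
  have hq := (twistedTuple_iff hu).1 ht
  have h : canExtend twistedB 8 labels [] = true :=
    (canExtend_iff _ allQuadruples_nil).2 ⟨_, by simp,
      (List.reverse_perm _).subperm.trans (ofFn_subperm_labels hu), by simpa using hq⟩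
  rw [no_eight_twisted] at h
  exact Bool.false_ne_true h

/-- There exists a generalized twisted pre-rotation system on 12 elements
that does not contain the perfect twisted configuration `T_8`; in particular
`N_gt(T_8) > 12`. -/
theorem gen_twisted_twelve_without_T8 :
    ∃ P : PreRotSys (Fin 12), GenTwisted P ∧ ¬ ContainsT P 8 :=
  ⟨rotSys, genTwisted_rotSys, not_containsT_rotSys⟩
end

section
/- Up to isomorphism (relabelling, possibly followed by reflection), there are exactly 9 generalized twisted pre-rotation systems on a 7-element set. -/
/-!
A system whose five-element subsets are all of twisted type is determined by its ternary relations,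
which are stored as bit sets. Starting from the unique five-element system, two exhaustive searches,
one for each further element, are verified by kernel computation: every leaf comes with an
isomorphism from one of the listed representatives. A numerical invariant built from crossings
separates the nine representatives on seven elements.
-/

namespace SevenTwisted

section CyclicPerm

variable {α : Type*} {f : Equiv.Perm α} {S : Finset α} {a b c d e : α}

lemma apply_mem (hf : IsCyclicPermOn f S) (ha : a ∈ S) : f a ∈ S := by
  by_contra h
  have h1 := hf.1 _ h
  rw [f.injective h1] at h
  exact h ha

lemma iterate_mem (hf : IsCyclicPermOn f S) (ha : a ∈ S) (i : ℕ) : f^[i] a ∈ S := by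
  induction i with
  | zero => exact ha
  | succ i ih => rw [Function.iterate_succ_apply']; exact apply_mem hf ih

lemma minimalPeriod_eq (hf : IsCyclicPermOn f S) (ha : a ∈ S) :
    Function.minimalPeriod f a = S.card := by
  classical
  obtain ⟨k, hk⟩ := hf.2 _ (apply_mem hf ha) _ ha
  have hper : Function.IsPeriodicPt f (k + 1) a := by
    rw [Function.IsPeriodicPt, Function.IsFixedPt, Function.iterate_succ_apply]
    exact hk
  have hpos := hper.minimalPeriod_pos (Nat.succ_pos k)
  have hS : S = (Finset.range (Function.minimalPeriod f a)).image (fun i => f^[i] a) := by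
    ext x
    simp only [Finset.mem_image, Finset.mem_range]
    constructor
    · intro hx
      obtain ⟨m, rfl⟩ := hf.2 _ ha _ hx
      exact ⟨m % Function.minimalPeriod f a, Nat.mod_lt _ hpos,
        Function.iterate_mod_minimalPeriod_eq⟩
    · rintro ⟨i, -, rfl⟩
      exact iterate_mem hf ha i
  conv_rhs => rw [hS]
  rw [Finset.card_image_of_injOn, Finset.card_range]
  intro i hi j hj hij
  exact Function.iterate_injOn_Iio_minimalPeriod (by simpa using hi) (by simpa using hj) hij

lemma iterate_inj (hf : IsCyclicPermOn f S) (ha : a ∈ S) {i j : ℕ} (hi : i < S.card)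
    (hj : j < S.card) (h : f^[i] a = f^[j] a) : i = j := by
  rw [← minimalPeriod_eq hf ha] at hi hj
  exact Function.iterate_injOn_Iio_minimalPeriod hi hj h

lemma iterate_card (hf : IsCyclicPermOn f S) (ha : a ∈ S) : f^[S.card] a = a := by
  rw [← minimalPeriod_eq hf ha]
  exact Function.iterate_minimalPeriod

lemma cycOrd_mem (hf : IsCyclicPermOn f S) (hb : b ∈ S) (h : CycOrd f S b c d) :
    c ∈ S ∧ d ∈ S ∧ b ≠ c ∧ b ≠ d ∧ c ≠ d := by
  obtain ⟨i, j, hi, hij, hj, rfl, rfl⟩ := h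
  refine ⟨iterate_mem hf hb i, iterate_mem hf hb j, fun h => ?_, fun h => ?_, fun h => ?_⟩
  · have := iterate_inj hf hb (i := 0) (by omega) (by omega) h
    omega
  · have := iterate_inj hf hb (i := 0) (by omega) (by omega) h
    omega
  · have := iterate_inj hf hb (by omega) (by omega) h
    omega

lemma cycOrd_rotate (hf : IsCyclicPermOn f S) (hb : b ∈ S) (h : CycOrd f S b c d) :
    CycOrd f S c d b := by
  obtain ⟨i, j, hi, hij, hj, rfl, rfl⟩ := h
  refine ⟨j - i, S.card - i, by omega, by omega, by omega, ?_, ?_⟩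
  · rw [← Function.iterate_add_apply, Nat.sub_add_cancel hij.le]
  · rw [← Function.iterate_add_apply, Nat.sub_add_cancel (by omega), iterate_card hf hb]

lemma cycOrd_asymm (hf : IsCyclicPermOn f S) (hb : b ∈ S) (h : CycOrd f S b c d) :
    ¬ CycOrd f S b d c := by
  obtain ⟨i, j, hi, hij, hj, rfl, rfl⟩ := h
  rintro ⟨i', j', hi', hij', hj', h1, h2⟩
  have := iterate_inj hf hb (by omega) (by omega) h1
  have := iterate_inj hf hb (by omega) (by omega) h2
  omega

lemma cycOrd_trans (hf : IsCyclicPermOn f S) (hb : b ∈ S) (h : CycOrd f S b c d)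
    (h' : CycOrd f S b d e) : CycOrd f S b c e := by
  obtain ⟨i, j, hi, hij, hj, rfl, rfl⟩ := h
  obtain ⟨i', j', hi', hij', hj', h1, rfl⟩ := h'
  have := iterate_inj hf hb (by omega) (by omega) h1
  exact ⟨i, j', hi, by omega, hj', rfl, rfl⟩

lemma cycOrd_inv (hf : IsCyclicPermOn f S) (hb : b ∈ S) (h : CycOrd f S b c d) :
    CycOrd f⁻¹ S b d c := by
  obtain ⟨i, j, hi, hij, hj, rfl, rfl⟩ := h
  have key : ∀ m ≤ S.card, (⇑f⁻¹)^[S.card - m] b = f^[m] b := by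
    intro m hm
    apply (f.injective.iterate (S.card - m))
    rw [← Function.iterate_add_apply, Nat.sub_add_cancel hm, iterate_card hf hb]
    exact (Function.LeftInverse.iterate (g := ⇑f) (f := ⇑f⁻¹) f.apply_symm_apply _) b
  exact ⟨S.card - j, S.card - i, by omega, by omega, by omega, key j (by omega), key i (by omega)⟩

lemma isCyclicPermOn_inv (hf : IsCyclicPermOn f S) : IsCyclicPermOn f⁻¹ S := by
  refine ⟨fun a ha => ?_, fun a ha b hb => ?_⟩
  · rw [Equiv.Perm.inv_eq_iff_eq, hf.1 a ha]
  · obtain ⟨k, rfl⟩ := hf.2 b hb a ha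
    exact ⟨k, (Function.LeftInverse.iterate (g := ⇑f⁻¹) (f := ⇑f) f.symm_apply_apply _) b⟩

lemma conj_iterate (e f : Equiv.Perm α) (i : ℕ) (a : α) :
    (⇑(e * f * e⁻¹))^[i] a = e (f^[i] (e⁻¹ a)) := by
  induction i with
  | zero => simp
  | succ i ih => rw [Function.iterate_succ_apply', ih, Function.iterate_succ_apply']; simp

/-- If `q` lists the elements of `S` in an order witnessed by `CycOrd`, then it lists them in the
order of the cycle. -/
lemma iterate_eq_of_cycOrd (hf : IsCyclicPermOn f S) (hS : S.card = 6) {q : ℕ → α}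
    (h0 : q 0 ∈ S) (h : ∀ i ∈ [1, 2, 3, 4], CycOrd f S (q 0) (q i) (q (i + 1))) :
    ∀ i < 6, f^[i] (q 0) = q i := by
  simp only [List.mem_cons, List.not_mem_nil, or_false, forall_eq_or_imp, forall_eq] at h
  obtain ⟨⟨i1, j1, a1, b1, c1, d1, e1⟩, ⟨i2, j2, a2, b2, c2, d2, e2⟩,
    ⟨i3, j3, a3, b3, c3, d3, e3⟩, ⟨i4, j4, a4, b4, c4, d4, e4⟩⟩ := h
  have h2 := iterate_inj hf h0 (by omega) (by omega) (e1.trans d2.symm)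
  have h3 := iterate_inj hf h0 (by omega) (by omega) (e2.trans d3.symm)
  have h4 := iterate_inj hf h0 (by omega) (by omega) (e3.trans d4.symm)
  obtain ⟨rfl, rfl, rfl, rfl, rfl⟩ : i1 = 1 ∧ i2 = 2 ∧ i3 = 3 ∧ i4 = 4 ∧ j4 = 5 := by omega
  intro i hi
  interval_cases i
  exacts [rfl, d1, d2, d3, d4, e4]

end CyclicPerm

section PreRot

variable {α : Type*} [Fintype α] [DecidableEq α] {P P' P'' : PreRotSys α}

/-- The order relation around `v`, without the degenerate case `b = v`. -/
def Ord (P : PreRotSys α) (v b c d : α) : Prop := b ≠ v ∧ rotOrd P v b c d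

lemma Ord.ne {v b c d : α} (h : Ord P v b c d) :
    v ≠ b ∧ v ≠ c ∧ v ≠ d ∧ b ≠ c ∧ b ≠ d ∧ c ≠ d := by
  have := cycOrd_mem (P.cyc v) (by simp [h.1]) h.2
  simp only [Finset.mem_erase, Finset.mem_univ, and_true] at this
  exact ⟨h.1.symm, this.1.symm, this.2.1.symm, this.2.2⟩

lemma Ord.rotate {v b c d : α} (h : Ord P v b c d) : Ord P v c d b :=
  ⟨h.ne.2.1.symm, cycOrd_rotate (P.cyc v) (by simp [h.1]) h.2⟩

lemma Ord.asymm {v b c d : α} (h : Ord P v b c d) : ¬ Ord P v b d c :=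
  fun h' => cycOrd_asymm (P.cyc v) (by simp [h.1]) h.2 h'.2

lemma Ord.trans {v b c d e : α} (h : Ord P v b c d) (h' : Ord P v b d e) : Ord P v b c e :=
  ⟨h.1, cycOrd_trans (P.cyc v) (by simp [h.1]) h.2 h'.2⟩

lemma isoPRS_trans (h : IsoPRS P P') (h' : IsoPRS P' P'') : IsoPRS P P'' := by
  obtain ⟨e, he⟩ := h
  obtain ⟨e', he'⟩ := h'
  refine ⟨e' * e, ?_⟩
  rcases he with he | he <;> rcases he' with he' | he'
  · left; intro v; rw [Equiv.Perm.mul_apply, he', he]; group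
  · right; intro v; rw [Equiv.Perm.mul_apply, he', he]; group
  · right; intro v; rw [Equiv.Perm.mul_apply, he', he]; group
  · left; intro v; rw [Equiv.Perm.mul_apply, he', he]; group

lemma ord_of_conj {P P' : PreRotSys α} {e : Equiv.Perm α} {v : α}
    (h : P'.rot (e v) = e * P.rot v * e⁻¹) {b c d : α} :
    Ord P' (e v) (e b) (e c) (e d) ↔ Ord P v b c d := by
  simp only [Ord, rotOrd, CycOrd, h, conj_iterate]
  simp [Finset.card_erase_of_mem]

lemma ord_of_conj_inv {P P' : PreRotSys α} {e : Equiv.Perm α} {v : α}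
    (h : P'.rot (e v) = (e * P.rot v * e⁻¹)⁻¹) {b c d : α} :
    Ord P' (e v) (e b) (e d) (e c) ↔ Ord P v b c d := by
  have h' : P'.rot (e v) = e * (P.rot v)⁻¹ * e⁻¹ := by rw [h]; group
  have h1 : Ord P' (e v) (e b) (e d) (e c) ↔
      b ≠ v ∧ CycOrd (P.rot v)⁻¹ (Finset.univ.erase v) b d c := by
    simp only [Ord, rotOrd, CycOrd, h', conj_iterate]
    simp [Finset.card_erase_of_mem]
  rw [h1, Ord]
  refine and_congr_right fun hb => ⟨fun h => ?_, fun h => ?_⟩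
  · show CycOrd (P.rot v) (Finset.univ.erase v) b c d
    simpa using cycOrd_inv (isCyclicPermOn_inv (P.cyc v)) (by simp [hb]) h
  · exact cycOrd_inv (P.cyc v) (by simp [hb]) h

lemma isCyclicPermOn_conj {f : Equiv.Perm α} {v : α} (e : Equiv.Perm α)
    (hf : IsCyclicPermOn f (Finset.univ.erase (e v))) :
    IsCyclicPermOn (e⁻¹ * f * e⁻¹⁻¹) (Finset.univ.erase v) := by
  refine ⟨fun a ha => ?_, fun a ha b hb => ?_⟩
  · have := hf.1 (e a) (by simpa using ha)
    simp [this]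
  · obtain ⟨k, hk⟩ := hf.2 (e a) (by simpa using ha) (e b) (by simpa using hb)
    exact ⟨k, by rw [conj_iterate]; simp [hk]⟩

/-- The pullback of `P` along a relabelling, reflected if `r` is true. -/
def pullback (P : PreRotSys α) (e : Equiv.Perm α) (r : Bool) : PreRotSys α where
  rot v := e⁻¹ * (if r then (P.rot (e v))⁻¹ else P.rot (e v)) * e⁻¹⁻¹
  cyc v := by
    apply isCyclicPermOn_conj
    split_ifs
    exacts [isCyclicPermOn_inv (P.cyc _), P.cyc _]

lemma isoPRS_pullback (P : PreRotSys α) (e : Equiv.Perm α) (r : Bool) :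
    IsoPRS P (pullback P e r) := by
  refine ⟨e⁻¹, ?_⟩
  cases r
  · left; intro v; simp [pullback]
  · right; intro v; simp [pullback, mul_assoc]

lemma ord_pullback (P : PreRotSys α) (e : Equiv.Perm α) (r : Bool) (v b c d : α) :
    Ord (pullback P e r) v b c d ↔
      if r then Ord P (e v) (e b) (e d) (e c) else Ord P (e v) (e b) (e c) (e d) := by
  cases r
  · have := ord_of_conj (P := P) (P' := pullback P e false) (e := e⁻¹) (v := e v)
      (by simp [pullback]) (b := e b) (c := e c) (d := e d)
    simpa using this
  · have := ord_of_conj_inv (P := P) (P' := pullback P e true) (e := e⁻¹) (v := e v)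
      (by simp [pullback, mul_assoc]) (b := e b) (c := e d) (d := e c)
    simpa using this

lemma crosses_iff_ord {p q r s : α} : Crosses P p q r s ↔
    (Ord P p q r s ∧ Ord P q p r s ∧ Ord P r p q s ∧ Ord P s p q r) ∨
    (Ord P p q s r ∧ Ord P q p s r ∧ Ord P r p s q ∧ Ord P s p r q) := by
  constructor
  · rintro ⟨⟨h1, h2, h3, h4, h5, h6⟩, h | h⟩
    · exact Or.inl ⟨⟨h1.symm, h.1⟩, ⟨h1, h.2.1⟩, ⟨h2, h.2.2.1⟩, ⟨h3, h.2.2.2⟩⟩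
    · exact Or.inr ⟨⟨h1.symm, h.1⟩, ⟨h1, h.2.1⟩, ⟨h2, h.2.2.1⟩, ⟨h3, h.2.2.2⟩⟩
  · rintro (h | h)
    · exact ⟨h.1.ne, Or.inl ⟨h.1.2, h.2.1.2, h.2.2.1.2, h.2.2.2.2⟩⟩
    · have := h.1.ne
      exact ⟨⟨this.1, this.2.2.1, this.2.1, this.2.2.2.2.1, this.2.2.2.1, this.2.2.2.2.2.symm⟩,
        Or.inr ⟨h.1.2, h.2.1.2, h.2.2.1.2, h.2.2.2.2⟩⟩

lemma isoPRS_crosses (h : IsoPRS P P') : ∃ e : Equiv.Perm α, ∀ p q r s,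
    Crosses P' (e p) (e q) (e r) (e s) ↔ Crosses P p q r s := by
  obtain ⟨e, he | he⟩ := h
  · exact ⟨e, fun p q r s => by simp only [crosses_iff_ord, ord_of_conj (he _)]⟩
  · exact ⟨e, fun p q r s => by simp only [crosses_iff_ord, ord_of_conj_inv (he _)]; exact or_comm⟩

/-- Every five elements of `P` form a configuration of twisted type. -/
def AllTwisted (P : PreRotSys α) : Prop :=
  ∀ w : Fin 5 → α, Function.Injective w →
    ∃ e : Equiv.Perm (Fin 5), TwistedTuple P (fun x => w (e x))

lemma allTwisted_of_iso (h : IsoPRS P P') (hP : AllTwisted P) : AllTwisted P' := by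
  obtain ⟨e, he⟩ := isoPRS_crosses h
  intro w hw
  obtain ⟨g, hg⟩ := hP (e.symm ∘ w) (e.symm.injective.comp hw)
  refine ⟨g, fun a b c d hab hbc hcd => ?_⟩
  have := hg a b c d hab hbc hcd
  simpa [← he] using this

end PreRot

/-- The tuples `(v, b, c, d)` of distinct elements of `Fin 5` with `b` smaller than `c` and `d`. -/
def slots : List (Fin 5 × Fin 5 × Fin 5 × Fin 5) :=
  [(0, 1, 2, 3), (0, 1, 2, 4), (0, 1, 3, 2), (0, 1, 3, 4), (0, 1, 4, 2), (0, 1, 4, 3),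
   (0, 2, 3, 4), (0, 2, 4, 3), (1, 0, 2, 3), (1, 0, 2, 4), (1, 0, 3, 2), (1, 0, 3, 4),
   (1, 0, 4, 2), (1, 0, 4, 3), (1, 2, 3, 4), (1, 2, 4, 3), (2, 0, 1, 3), (2, 0, 1, 4),
   (2, 0, 3, 1), (2, 0, 3, 4), (2, 0, 4, 1), (2, 0, 4, 3), (2, 1, 3, 4), (2, 1, 4, 3),
   (3, 0, 1, 2), (3, 0, 1, 4), (3, 0, 2, 1), (3, 0, 2, 4), (3, 0, 4, 1), (3, 0, 4, 2),
   (3, 1, 2, 4), (3, 1, 4, 2), (4, 0, 1, 2), (4, 0, 1, 3), (4, 0, 2, 1), (4, 0, 2, 3),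
   (4, 0, 3, 1), (4, 0, 3, 2), (4, 1, 2, 3), (4, 1, 3, 2)]

/-- The rotation systems of twisted type on `Fin 5`, as bit sets indexed by `slots`. -/
def twistedPatterns : List ℕ :=
  [323385777244, 323385782641, 323386891339, 323388273059, 323390180939, 323391557262,
   323391567028, 323392681123, 323672109387, 323673485710, 323676775310, 324029096779,
   324030215243, 324514237259, 324514247025, 324515623348, 324867935051, 324867939420,
   325153157468, 325154271563, 396400216945, 396404625009, 396407115427, 396685429596,
   396686548060, 396686553457, 396687920014, 396689843057, 396691219380, 396692328078,
   396692337844, 397040241483, 397040251249, 397044659313, 397530057652, 397531171747,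
   397882379121, 397883497585, 398168705867, 398168710236, 486594530211, 486595648675,
   486880861326, 486884150926, 486884156323, 487232064331, 487232068700, 487234559118,
   487234564515, 487236472395, 487236482161, 487237854115, 487237858484, 487722994595,
   487722998964, 488076696756, 488077810851, 488360533084, 488360538481, 488363028899,
   611148598876, 611151089294, 611151094691, 611433816924, 611434931019, 611788628811,
   611788633180, 612273769291, 612273773660, 612275145614, 612275155380, 612277063260,
   612277068657, 612279559075, 612279563444, 612627471452, 612627476849, 612630766449,
   612915979100, 612917097564, 701342917539, 701342921908, 701628130190, 701629248654,
   701980456028, 701981570123, 702466968462, 702471376526, 702471386292, 702819289931,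
   702819299697, 702820408395, 702821784718, 702823707761, 702825074318, 702825079715,
   702826198179, 703104512348, 703107002766, 703111410830, 774357356212, 774358470307,
   774643688355, 774643692724, 774996004427, 774997380750, 774997390516, 775481412532,
   775482530996, 775834852465, 775838142065, 775839518388, 776118946652, 776120060747,
   776120070513, 776121446836, 776123354716, 776124736436, 776125845134, 776125850531]

section FivePoints

/-- The position of `x` around `v` in the twisted system on `Fin 5`. -/
def t5Pos (v x : Fin 5) : ℕ := (119069995844496 >>> (2 * (5 * v.val + x.val))) % 4

/-- The orientation of `b, c, d` around `v` in the twisted system on `Fin 5`, reflected if `o` is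
false. -/
def t5 (o : Bool) (v b c d : Fin 5) : Bool :=
  match o with
  | true => Nat.blt ((t5Pos v c + 4 - t5Pos v b) % 4) ((t5Pos v d + 4 - t5Pos v b) % 4)
  | false => Nat.blt ((t5Pos v d + 4 - t5Pos v b) % 4) ((t5Pos v c + 4 - t5Pos v b) % 4)

variable {α : Type*} [Fintype α] [DecidableEq α] {P : PreRotSys α}

lemma t5_of_slots {o : Bool} {R : Fin 5 → Fin 5 → Fin 5 → Fin 5 → Prop}
    (rot : ∀ v b c d, R v b c d → R v c d b) (asymm : ∀ v b c d, R v b c d → ¬ R v d c b)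
    (h : ∀ t ∈ slots, t5 o t.1 t.2.1 t.2.2.1 t.2.2.2 → R t.1 t.2.1 t.2.2.1 t.2.2.2)
    {v b c d : Fin 5} (hd : [v, b, c, d].Nodup) : R v b c d ↔ t5 o v b c d := by
  have key : ∀ o v b c d, [v, b, c, d].Nodup → t5 o v b c d →
      ∃ t ∈ slots, t5 o t.1 t.2.1 t.2.2.1 t.2.2.2 ∧
        (t = (v, b, c, d) ∨ t = (v, c, d, b) ∨ t = (v, d, b, c)) := by
    decide +kernel
  have total : ∀ o v b c d, [v, b, c, d].Nodup → ¬ t5 o v b c d → t5 o v d c b := by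
    decide +kernel
  have pos : ∀ v b c d, [v, b, c, d].Nodup → t5 o v b c d → R v b c d := by
    intro v b c d hd ht
    obtain ⟨t, hts, ht5, rfl | rfl | rfl⟩ := key o v b c d hd ht
    · exact h _ hts ht5
    · exact rot _ _ _ _ (rot _ _ _ _ (h _ hts ht5))
    · exact rot _ _ _ _ (h _ hts ht5)
  refine ⟨fun hR => ?_, pos v b c d hd⟩
  by_contra hn
  refine asymm _ _ _ _ hR (pos v d c b ?_ (total o v b c d hd hn))
  simp only [List.nodup_cons, List.mem_cons, List.not_mem_nil, not_or] at hd ⊢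
  grind

lemma exists_orientation {u : Fin 5 → α} (h : TwistedTuple P u) :
    ∃ o, ∀ t ∈ slots, t5 o t.1 t.2.1 t.2.2.1 t.2.2.2 →
      Ord P (u t.1) (u t.2.1) (u t.2.2.1) (u t.2.2.2) := by
  have h0 := crosses_iff_ord.1 (h 1 2 3 4 (by decide) (by decide) (by decide)).1
  have h1 := crosses_iff_ord.1 (h 0 2 3 4 (by decide) (by decide) (by decide)).1
  have h2 := crosses_iff_ord.1 (h 0 1 3 4 (by decide) (by decide) (by decide)).1
  have h3 := crosses_iff_ord.1 (h 0 1 2 4 (by decide) (by decide) (by decide)).1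
  have h4 := crosses_iff_ord.1 (h 0 1 2 3 (by decide) (by decide) (by decide)).1
  clear h
  have opp : ∀ {v b c d e}, Ord P v b c d → Ord P v b d e → Ord P v b e c → False :=
    fun h h' h'' => (h.trans h').asymm h''
  have r : ∀ {v b c d}, Ord P v b c d → Ord P v c d b := fun h => h.rotate
  rcases h0 with ⟨a0, b0, c0, d0⟩ | ⟨a0, b0, c0, d0⟩ <;>
  rcases h1 with ⟨a1, b1, c1, d1⟩ | ⟨a1, b1, c1, d1⟩ <;>
  rcases h2 with ⟨a2, b2, c2, d2⟩ | ⟨a2, b2, c2, d2⟩ <;>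
  rcases h3 with ⟨a3, b3, c3, d3⟩ | ⟨a3, b3, c3, d3⟩ <;>
  rcases h4 with ⟨a4, b4, c4, d4⟩ | ⟨a4, b4, c4, d4⟩
  all_goals try (exfalso; grind only)
  · refine ⟨false, ?_⟩
    simp only [slots, List.forall_mem_cons, List.not_mem_nil, false_imp_iff, implies_true,
      and_true]
    simp [t5, t5Pos, *]
  · refine ⟨true, ?_⟩
    simp only [slots, List.forall_mem_cons, List.not_mem_nil, false_imp_iff, implies_true,
      and_true]
    simp [t5, t5Pos, *]

lemma t5_iff {u : Fin 5 → α} (h : TwistedTuple P u) : ∃ o, ∀ v b c d, [v, b, c, d].Nodup →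
    (Ord P (u v) (u b) (u c) (u d) ↔ t5 o v b c d) := by
  obtain ⟨o, ho⟩ := exists_orientation h
  refine ⟨o, fun v b c d hd => t5_of_slots (R := fun v b c d => Ord P (u v) (u b) (u c) (u d))
    (fun _ _ _ _ h => h.rotate) (fun _ _ _ _ h h' => h.asymm h'.rotate.rotate) ho hd⟩

/-- The number whose binary digits are the values of `χ` on a list. -/
def pack {β : Type} (χ : β → Bool) : List β → ℕ
  | [] => 0
  | t :: ts => (χ t).toNat + 2 * pack χ ts

lemma pack_t5_mem (o : Bool) : ∀ a b : Fin 5, b ≠ a → ∀ c, c ≠ a → c ≠ b →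
    ∀ d, d ≠ a → d ≠ b → d ≠ c → ∀ e, e ≠ a → e ≠ b → e ≠ c → e ≠ d →
    pack (fun t => t5 o (![a, b, c, d, e] t.1) (![a, b, c, d, e] t.2.1)
      (![a, b, c, d, e] t.2.2.1) (![a, b, c, d, e] t.2.2.2)) slots ∈ twistedPatterns := by
  cases o <;> decide +kernel

end FivePoints

/-- The five-element subsets of `{0, …, 5}` other than `{0, 1, 2, 3, 4}`. -/
def fiveSubsetsSix : List (Fin 5 → Fin 7) :=
  [![0, 1, 2, 3, 5], ![0, 2, 3, 4, 5], ![0, 1, 2, 4, 5], ![0, 1, 3, 4, 5], ![1, 2, 3, 4, 5]]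

/-- The five-element subsets of `Fin 7` that contain `6`. -/
def fiveSubsetsSeven : List (Fin 5 → Fin 7) :=
  [![0, 1, 2, 3, 6], ![1, 2, 3, 4, 6], ![0, 1, 3, 4, 6], ![0, 2, 3, 4, 6], ![0, 2, 3, 5, 6],
   ![0, 1, 2, 5, 6], ![2, 3, 4, 5, 6], ![0, 1, 2, 4, 6], ![0, 2, 4, 5, 6], ![1, 2, 3, 5, 6],
   ![0, 1, 3, 5, 6], ![0, 3, 4, 5, 6], ![0, 1, 4, 5, 6], ![1, 3, 4, 5, 6], ![1, 2, 4, 5, 6]]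

/-- Representatives of the systems on `{0, …, 5}` with all five-element subsets of twisted type,
as lists of tuples in base seven (see `Holds`). -/
def sixTypes : List (List ℕ) :=
  [[444, 445, 492, 494, 541, 542, 590, 591, 592, 740, 837, 844, 885, 892, 932, 1083, 1128, 1132,
   1134, 1139, 1275, 1292, 1426, 1471, 1475, 1477, 1482, 1520, 1521, 1524, 1526, 1528, 1531, 1533,
   1534, 1538, 1618, 1634, 1816, 1817, 1820, 1823, 1824, 1864, 1866, 1869, 1871, 1873, 1876, 1877,
   1913, 1914, 1918, 1920, 1921, 1925, 1926, 1932, 1933, 1934],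
   [444, 445, 492, 494, 541, 542, 740, 837, 844, 885, 892, 941, 942, 1083, 1128, 1132, 1134, 1139,
   1283, 1285, 1292, 1426, 1471, 1475, 1477, 1482, 1520, 1521, 1524, 1526, 1528, 1531, 1533, 1534,
   1538, 1626, 1627, 1634, 1766, 1767, 1768, 1814, 1816, 1817, 1820, 1863, 1864, 1866, 1869, 1876,
   1877, 1912, 1913, 1914, 1918, 1925, 1926, 1932, 1933, 1934],
   [444, 445, 492, 494, 541, 542, 544, 740, 837, 844, 885, 887, 892, 941, 942, 1083, 1128, 1132,
   1134, 1139, 1230, 1283, 1285, 1292, 1471, 1477, 1482, 1520, 1521, 1526, 1528, 1531, 1533, 1534,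
   1538, 1624, 1626, 1627, 1631, 1634, 1638, 1766, 1767, 1768, 1814, 1816, 1817, 1820, 1863, 1864,
   1866, 1869, 1876, 1877, 1912, 1913, 1914, 1926, 1933, 1934],
   [444, 445, 446, 492, 494, 495, 541, 542, 590, 837, 844, 885, 892, 894, 941, 942, 1128, 1132,
   1134, 1139, 1237, 1276, 1281, 1283, 1285, 1288, 1292, 1426, 1471, 1475, 1477, 1520, 1521, 1524,
   1526, 1528, 1533, 1534, 1538, 1618, 1619, 1624, 1626, 1627, 1631, 1632, 1634, 1639, 1767, 1768,
   1814, 1816, 1817, 1820, 1863, 1866, 1877, 1914, 1932, 1934]]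

/-- The rotations of the nine representatives: octal digit `6 * v + i` is the `i`-th neighbour
of `v`. -/
def repCodes : List ℕ :=
  [46961907814685772590068463210898610385, 46961908161308983589974940182668073169,
   46889215659343286044807250561982486737, 46961908161283596050917307174881519825,
   46961908161282802691330572441423636689, 59028805714530012936157729545265567953,
   34840577662957595213519184381129968849, 55230640909050372395603103117817857713,
   23518687498917239141426210711531603857]

/-- The inverse of `repCodes`: octal digit `7 * v + x` is the position of `x` around `v`. -/
def repPosCodes : List ℕ :=
  [7508682264605320960592910719948893418042432, 7508692898104768686261467223622700676559936,
   4721769679527905394904059697157568468497472, 7508692898095262540166909966363641144063040,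
   7508692898090201838906238624433552336532544, 15474011909491915855063117562784719838786624,
   6165289825459671254903759551598562663908416, 15078614432624162636111046913434825588655744,
   9133190284277008709932270854605352871839296]

/-- For each representative and each five-element subset, a twisted labelling of that subset,
in base seven. -/
def repTwistedCodes : List (List ℕ) :=
  [[16244, 10921, 10578, 8177, 10774, 10767, 14094, 14093, 14086, 10773, 10766, 4732, 4725, 14780,
   12379, 4718, 14779, 12378, 14772, 12371, 10738],
   [16244, 14143, 14142, 14135, 10774, 10767, 14094, 14093, 14086, 10773, 10766, 14116, 14115,
   14780, 12379, 14114, 14779, 12378, 14772, 12371, 10738],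
   [16244, 12673, 12672, 12665, 14872, 10767, 14094, 14093, 14086, 10773, 10766, 12310, 12309,
   10724, 12379, 12308, 10381, 12378, 7980, 12371, 10738],
   [15368, 16201, 15012, 15011, 15172, 10767, 16152, 14669, 14668, 15123, 10766, 16174, 16173,
   14780, 12379, 16172, 14473, 12378, 14472, 12371, 10738],
   [16244, 15019, 15012, 15011, 14872, 10767, 14676, 14669, 14668, 14529, 10766, 16174, 16173,
   14480, 12379, 16172, 14473, 12378, 14472, 12371, 10738],
   [14186, 14137, 14130, 14129, 14872, 12471, 10962, 10619, 8218, 10773, 10766, 10276, 7875, 10724,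
   10717, 5474, 10381, 10374, 7980, 7973, 10738],
   [16244, 16195, 16188, 16187, 14872, 12471, 14592, 14543, 8176, 14571, 10766, 14494, 7833, 14564,
   10717, 5432, 14515, 10374, 7980, 7973, 10738],
   [14186, 12667, 12996, 12995, 8668, 12471, 10962, 10619, 8218, 10773, 10766, 11746, 9345, 10934,
   10717, 12146, 10255, 10374, 7854, 7973, 10738],
   [15368, 15025, 16188, 16187, 15172, 12471, 10962, 11459, 9058, 10941, 10766, 11410, 9009, 10934,
   10717, 14660, 10087, 10374, 7686, 7973, 10738]]

/-- For each leaf of the first search, an isomorphism from a member of `sixTypes`: seven base-seven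
digits for the relabelling, then a digit for the reflection, then the index of the type. -/
def sixCerts : List ℕ :=
  [800667, 6565468, 12330269, 733467, 12297989, 6533188, 12246239, 6498268, 13127208, 18095070,
   1599334, 13069512, 13128090, 13127040, 18900049, 13069596, 1538266, 12303191, 12319997,
   1538560, 6501040, 6498982, 13070478, 12265841, 6498394, 1542676]

/-- For each leaf of the second search, an isomorphism from a representative, encoded as in
`sixCerts`. -/
def sevenCerts : List ℕ :=
  [800667, 6565468, 699825, 6464626, 12330269, 5977258, 401583, 18095070, 11624381, 23859871,
   7020887, 11742059, 5977222, 12785712, 13138638, 1407352, 1609036, 7172153, 7373837, 12668046,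
   18903439, 24668240, 7020911, 956860, 12229427, 29624672, 23086789, 29523830, 23086783, 7022597,
   7024655, 35389473, 34990029, 7020833, 29124386, 18651277, 34683585, 23170789, 29036462,
   41154274, 615789, 23565205, 46919075, 40683874, 40566064, 18210859, 23565223, 7185467, 7186055,
   35111607, 46876505, 29041628, 35209797, 35346903, 29037512, 23632423, 11985173, 29036630,
   7192229, 35288631, 11834147, 11834441, 18653041, 24417842, 18655099, 24419900, 24416078,
   11846789, 35204631, 47323854, 17800404, 47324022, 47407854, 17800422, 41525453, 46151159,
   46641209, 41428301, 46147043, 35205681, 17867622, 35204799]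

/-- The value `k n`, arranged so that kernel reduction evaluates `n` first. -/
def force {β : Type} (n : ℕ) (k : ℕ → β) : β :=
  match n with
  | 0 => k 0
  | m + 1 => k (Nat.succ m)

def filterK {β : Type} (p : ℕ → Bool) : List ℕ → (List ℕ → β) → β
  | [], k => k []
  | t :: T, k => match p t with
    | true => filterK p T fun R => k (t :: R)
    | false => filterK p T k

def mapK {β : Type} (f : ℕ → ℕ) : List ℕ → (List ℕ → β) → β
  | [], k => k []
  | t :: T, k => force (f t) fun y => mapK f T fun R => k (y :: R)

/-- From each table `T` with mask `N`, keep the entries that contain the part of `t` within `N`. -/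
def restrictK {β : Type} (t : ℕ) : List ℕ → List (List ℕ) → (List (List ℕ) → β) → β
  | N :: Ns, T :: Ts, k =>
    force (Nat.land t N) fun x =>
      filterK (fun s => Nat.beq (Nat.land x s) x) T fun T' =>
        restrictK t Ns Ts fun R => k (T' :: R)
  | _, _, k => k []

def foldOpt {σ : Type} (f : ℕ → σ → Option σ) : List ℕ → σ → Option σ
  | [], s => some s
  | t :: T, s => match f t s with
    | none => none
    | some s' => foldOpt f T s'

/-- Depth-first search over all choices of one entry from each table agreeing on overlaps. -/
def search {σ : Type} (leaf : ℕ → σ → Option σ) :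
    List ℕ → List (List ℕ) → ℕ → σ → Option σ
  | _ :: Ms, T :: Ts, a, s =>
    foldOpt (fun t s => force (Nat.lor a t) fun a' =>
      restrictK t Ms Ts fun Ts' => search leaf Ms Ts' a' s) T s
  | [], [], a, s => leaf a s
  | _, _, _, _ => none

def digit (c x : ℕ) : ℕ := c / 7 ^ x % 7

/-- Weights for which the sums over different four-element sets differ modulo `39`. -/
def weight (v : ℕ) : ℕ := [0, 1, 2, 4, 7, 21, 32].getD v 0

/-- The position of the statement `Ord P v b c d` in bit sets describing `P`. -/
def bitPos (v b c d : ℕ) : ℕ :=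
  (weight v + weight b + weight c + weight d) % 39 +
    39 * ((if b < v then 1 else 0) + (if c < v then 1 else 0) + (if d < v then 1 else 0)) +
    156 * (if c < d then 0 else 1)

/-- The tuple has distinct entries and its second entry is smaller than the last two. -/
def isMinFirst (v b c d : ℕ) : Bool :=
  Nat.blt b c && Nat.blt b d && !Nat.beq c d && !Nat.beq v b && !Nat.beq v c && !Nat.beq v d

def bitOf (i : ℕ) : ℕ :=
  match isMinFirst (digit i 0) (digit i 1) (digit i 2) (digit i 3) with
  | true => 2 ^ bitPos (digit i 0) (digit i 1) (digit i 2) (digit i 3)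
  | false => 0

def places (w : Fin 5 → Fin 7) : List ℕ :=
  slots.map fun t => 2 ^ bitPos (w t.1) (w t.2.1) (w t.2.2.1) (w t.2.2.2)

/-- The union of the members of a list of bit sets selected by the bits of `p`. -/
def expand : List ℕ → ℕ → ℕ
  | [], _ => 0
  | x :: xs, p => force (Nat.div p 2) fun q =>
    match Nat.beq (Nat.mod p 2) 1 with
    | true => Nat.lor x (expand xs q)
    | false => expand xs q

def union : List ℕ → ℕ
  | [] => 0
  | x :: xs => Nat.lor x (union xs)

def tablesK {β : Type} : List (Fin 5 → Fin 7) → (List ℕ → List (List ℕ) → β) → β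
  | [], k => k [] []
  | w :: ws, k => mapK id (places w) fun pl => force (union pl) fun M =>
      mapK (expand pl) twistedPatterns fun T => tablesK ws fun Ms Ts => k (M :: Ms) (T :: Ts)

def hasOrd (a v b c d : ℕ) : Bool :=
  (isMinFirst v b c d && a.testBit (bitPos v b c d)) ||
  (isMinFirst v c d b && a.testBit (bitPos v c d b)) ||
  (isMinFirst v d b c && a.testBit (bitPos v d b c))

/-- `c` encodes a relabelling and a reflection under which all statements in `l` become
members of `a`. -/
def checkIso (a c : ℕ) (l : List ℕ) : Bool :=
  ((List.range 7).all fun x => (List.range x).all fun y => !Nat.beq (digit c x) (digit c y)) &&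
  l.all fun i => match Nat.beq (digit c 7) 0 with
    | true => hasOrd a (digit c (digit i 0)) (digit c (digit i 1)) (digit c (digit i 2))
        (digit c (digit i 3))
    | false => hasOrd a (digit c (digit i 0)) (digit c (digit i 1)) (digit c (digit i 3))
        (digit c (digit i 2))

def leafCheck (targets : List (List ℕ)) (a : ℕ) : List ℕ → Option (List ℕ)
  | [] => none
  | c :: cs => match targets[c / 7 ^ 8]? with
    | none => none
    | some l => match checkIso a c l with
      | true => some cs
      | false => none

/-- Every extension of a member of `bases` by twisted systems on the members of `ws` is isomorphic,
as certified by `certs`, to a system containing a member of `targets`. -/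
def classify (ws : List (Fin 5 → Fin 7)) (bases targets : List (List ℕ)) (certs : List ℕ) : Bool :=
  tablesK ws fun Ms Ts => mapK id (bases.map fun l => union (l.map bitOf)) fun as =>
    (foldOpt (fun a s => restrictK a Ms Ts fun Ts' => search (leafCheck targets) Ms Ts' a s)
      as certs).isSome

/-- The tuple `(v, b, c, d)` in base seven. -/
def code (v b c d : ℕ) : ℕ := v + 7 * b + 49 * c + 343 * d

def fiveBase : List ℕ :=
  (slots.filter fun t => t5 true t.1 t.2.1 t.2.2.1 t.2.2.2).map fun t =>
    code t.1 t.2.1 t.2.2.1 t.2.2.2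

/-- The `i`-th neighbour of `v` in the `k`-th representative. -/
def repSeq (k v i : ℕ) : Fin 7 := Fin.ofNat 7 ((repCodes.getD k 0 >>> (3 * (6 * v + i))) % 8)

/-- The position of `x` around `v` in the `k`-th representative. -/
def repPos (k v x : ℕ) : ℕ := (repPosCodes.getD k 0 >>> (3 * (7 * v + x))) % 8

def repTargets (k : ℕ) : List ℕ :=
  (List.range 7).flatMap fun v => [1, 2, 3, 4].map fun i =>
    code v (repSeq k v 0) (repSeq k v i) (repSeq k v (i + 1))

section Soundness

lemma force_eq {β : Type} (n : ℕ) (k : ℕ → β) : force n k = k n := by cases n <;> rfl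

lemma filterK_eq {β : Type} (p : ℕ → Bool) (T : List ℕ) (k : List ℕ → β) :
    filterK p T k = k (T.filter p) := by
  induction T generalizing k with
  | nil => rfl
  | cons t T ih => cases h : p t <;> simp [filterK, h, ih]

lemma mapK_eq {β : Type} (f : ℕ → ℕ) (T : List ℕ) (k : List ℕ → β) :
    mapK f T k = k (T.map f) := by
  induction T generalizing k with
  | nil => rfl
  | cons t T ih => simp [mapK, force_eq, ih]

/-- The specification of `restrictK`. -/
def restrict (t : ℕ) (Ns : List ℕ) (Ts : List (List ℕ)) : List (List ℕ) :=
  List.zipWith (fun N T => T.filter fun s => Nat.beq (Nat.land (Nat.land t N) s) (Nat.land t N))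
    Ns Ts

lemma restrictK_eq {β : Type} (t : ℕ) (Ns : List ℕ) (Ts : List (List ℕ))
    (k : List (List ℕ) → β) : restrictK t Ns Ts k = k (restrict t Ns Ts) := by
  induction Ns generalizing Ts k with
  | nil => rfl
  | cons N Ns ih =>
    cases Ts with
    | nil => rfl
    | cons T Ts => simp [restrictK, force_eq, filterK_eq, ih, restrict]

lemma tablesK_eq {β : Type} (ws : List (Fin 5 → Fin 7)) (k : List ℕ → List (List ℕ) → β) :
    tablesK ws k = k (ws.map fun w => union (places w))
      (ws.map fun w => twistedPatterns.map (expand (places w))) := by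
  induction ws generalizing k with
  | nil => rfl
  | cons w ws ih => simp [tablesK, force_eq, mapK_eq, ih]

lemma foldOpt_mem {σ : Type} {f : ℕ → σ → Option σ} {T : List ℕ} {s s' : σ}
    (h : foldOpt f T s = some s') {t : ℕ} (ht : t ∈ T) : ∃ s₁ s₂, f t s₁ = some s₂ := by
  induction T generalizing s with
  | nil => simp at ht
  | cons x T ih =>
    rw [foldOpt] at h
    cases hx : f x s with
    | none => simp [hx] at h
    | some s₁ =>
      rw [hx] at h
      rcases List.mem_cons.1 ht with rfl | ht
      · exact ⟨_, _, hx⟩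
      · exact ih h ht

/-- Containment of bit sets. -/
def Contained (a n : ℕ) : Prop := ∀ i, a.testBit i → n.testBit i

lemma restrict_sound {n t : ℕ} (ht : Contained t n) {Ns : List ℕ} {Ts : List (List ℕ)}
    (h : List.Forall₂ (fun N T => Nat.land n N ∈ T) Ns Ts) :
    List.Forall₂ (fun N T => Nat.land n N ∈ T) Ns (restrict t Ns Ts) := by
  induction h with
  | nil => exact List.Forall₂.nil
  | @cons N T Ns Ts hN _ ih =>
    refine List.Forall₂.cons ?_ ih
    rw [List.mem_filter]
    refine ⟨hN, ?_⟩
    rw [Nat.beq_eq]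
    change (t &&& N) &&& (n &&& N) = t &&& N
    apply Nat.eq_of_testBit_eq
    intro i
    have := ht i
    simp only [Nat.testBit_land]
    grind

lemma search_sound {σ : Type} {leaf : ℕ → σ → Option σ} {n : ℕ} {Ms : List ℕ}
    {Ts : List (List ℕ)} (h : List.Forall₂ (fun M T => Nat.land n M ∈ T) Ms Ts) {a : ℕ} {s s' : σ}
    (ha : Contained a n) (hs : search leaf Ms Ts a s = some s') :
    ∃ a' s₁ s₂, Contained a' n ∧ leaf a' s₁ = some s₂ := by
  induction Ms generalizing Ts a s s' with
  | nil =>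
    cases h
    exact ⟨a, s, s', ha, hs⟩
  | cons M Ms ih =>
    rcases h with _ | ⟨hM, h⟩
    rw [search] at hs
    obtain ⟨s₁, s₂, hs⟩ := foldOpt_mem hs hM
    rw [force_eq, restrictK_eq] at hs
    have ht : Contained (Nat.land n M) n := fun i hi => by
      have : (n &&& M).testBit i = true := hi
      simp only [Nat.testBit_land, Bool.and_eq_true] at this
      exact this.1
    refine ih (restrict_sound ht h) (fun i hi => ?_) hs
    have : (a ||| Nat.land n M).testBit i = true := hi
    rw [Nat.testBit_lor, Bool.or_eq_true] at this
    exact this.elim (ha i) (ht i)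

lemma testBit_union {l : List ℕ} {i : ℕ} :
    (union l).testBit i ↔ ∃ x ∈ l, x.testBit i := by
  induction l with
  | nil => simp [union]
  | cons x l ih =>
    change (x ||| union l).testBit i ↔ _
    simp [ih]

lemma testBit_expand {β : Type} (f : β → ℕ) (χ : β → Bool) (l : List β) (i : ℕ) :
    (expand (l.map f) (pack χ l)).testBit i ↔ ∃ t ∈ l, χ t ∧ (f t).testBit i := by
  induction l with
  | nil => simp [expand]
  | cons x l ih =>
    have h1 : Nat.div (pack χ (x :: l)) 2 = pack χ l := by
      change ((χ x).toNat + 2 * pack χ l) / 2 = _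
      cases χ x <;> grind
    have h2 : Nat.mod (pack χ (x :: l)) 2 = (χ x).toNat := by
      change ((χ x).toNat + 2 * pack χ l) % 2 = _
      cases χ x <;> simp
    rw [List.map_cons, expand, force_eq, h1, h2]
    cases hx : χ x
    · simp [hx, ih]
    · change (f x ||| expand (l.map f) (pack χ l)).testBit i ↔ _
      simp [hx, ih]

lemma digit_lt (c x : ℕ) : digit c x < 7 := Nat.mod_lt _ (by norm_num)

/-- The base-seven digits of `c`. -/
def dig (c x : ℕ) : Fin 7 := ⟨digit c x, digit_lt c x⟩

/-- The statement `Ord P v b c d` for the tuple with base-seven digits `v, b, c, d`. -/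
def Holds (P : PreRotSys (Fin 7)) (i : ℕ) : Prop := Ord P (dig i 0) (dig i 1) (dig i 2) (dig i 3)

def minFirst : List (Fin 7 × Fin 7 × Fin 7 × Fin 7) :=
  (List.finRange 7 ×ˢ List.finRange 7 ×ˢ List.finRange 7 ×ˢ List.finRange 7).filter fun t =>
    isMinFirst t.1 t.2.1 t.2.2.1 t.2.2.2

/-- A linear-time check that a list has no duplicates and no members in the bit set `a`. -/
def nodupBits : List ℕ → ℕ → Bool
  | [], _ => true
  | i :: l, a => force a fun a => !a.testBit i && nodupBits l (Nat.lor a (2 ^ i))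

lemma nodup_of_nodupBits {l : List ℕ} {a : ℕ} (h : nodupBits l a = true) :
    l.Nodup ∧ ∀ i ∈ l, a.testBit i = false := by
  induction l generalizing a with
  | nil => simp
  | cons i l ih =>
    rw [nodupBits, force_eq, Bool.and_eq_true] at h
    obtain ⟨h1, h2⟩ := ih h.2
    have h3 : ∀ j ∈ l, (a ||| 2 ^ i).testBit j = false := h2
    simp only [Nat.testBit_lor, Nat.testBit_two_pow, Bool.or_eq_false_iff,
      decide_eq_false_iff_not] at h3
    refine ⟨List.nodup_cons.2 ⟨fun hi => (h3 i hi).2 rfl, h1⟩, fun j hj => ?_⟩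
    rcases List.mem_cons.1 hj with rfl | hj
    exacts [by simpa using h.1, (h3 j hj).1]

lemma bitPos_inj {v b c d v' b' c' d' : Fin 7} (h : isMinFirst v b c d)
    (h' : isMinFirst v' b' c' d') (e : bitPos v b c d = bitPos v' b' c' d') :
    v = v' ∧ b = b' ∧ c = c' ∧ d = d' := by
  have key : nodupBits (minFirst.map fun t => bitPos t.1 t.2.1 t.2.2.1 t.2.2.2) 0 = true := by
    decide +kernel
  have mem : ∀ {v b c d : Fin 7}, isMinFirst v b c d → (v, b, c, d) ∈ minFirst := fun h => by
    simp [minFirst, List.mem_filter, h]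
  have := List.inj_on_of_nodup_map (nodup_of_nodupBits key).1 (mem h) (mem h') e
  simpa using this

lemma isMinFirst_iff {v b c d : ℕ} :
    isMinFirst v b c d ↔ b < c ∧ b < d ∧ c ≠ d ∧ v ≠ b ∧ v ≠ c ∧ v ≠ d := by
  simp [isMinFirst, Nat.blt_eq, and_assoc, ← Bool.not_eq_true, Nat.beq_eq]

open Classical in
/-- The bit set describing `P`. -/
noncomputable def enc (P : PreRotSys (Fin 7)) : ℕ :=
  Nat.ofBits (n := 512) fun i => decide (∃ v b c d : Fin 7, isMinFirst v b c d ∧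
    bitPos v b c d = i.val ∧ Ord P v b c d)

lemma testBit_enc {P : PreRotSys (Fin 7)} {i : ℕ} : (enc P).testBit i ↔
    ∃ v b c d : Fin 7, isMinFirst v b c d ∧ bitPos v b c d = i ∧ Ord P v b c d := by
  by_cases hi : i < 512
  · simp [enc, Nat.testBit_ofBits_lt, hi]
  · rw [enc, Nat.testBit_ofBits_ge _ _ (by omega)]
    simp only [Bool.false_eq_true, false_iff]
    rintro ⟨v, b, c, d, -, h, -⟩
    rw [bitPos] at h
    split_ifs at h <;> omega

lemma testBit_enc_bitPos {P : PreRotSys (Fin 7)} {v b c d : Fin 7} (h : isMinFirst v b c d) :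
    (enc P).testBit (bitPos v b c d) ↔ Ord P v b c d := by
  rw [testBit_enc]
  refine ⟨?_, fun h' => ⟨v, b, c, d, h, rfl, h'⟩⟩
  rintro ⟨v', b', c', d', h', e, hO⟩
  obtain ⟨rfl, rfl, rfl, rfl⟩ := bitPos_inj h h' e.symm
  exact hO

lemma ord_of_hasOrd {P : PreRotSys (Fin 7)} {a : ℕ} (ha : Contained a (enc P)) {v b c d : Fin 7}
    (h : hasOrd a v b c d) : Ord P v b c d := by
  simp only [hasOrd, Bool.or_eq_true, Bool.and_eq_true] at h
  rcases h with (⟨h, h'⟩ | ⟨h, h'⟩) | ⟨h, h'⟩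
  · exact (testBit_enc_bitPos h).1 (ha _ h')
  · exact ((testBit_enc_bitPos h).1 (ha _ h')).rotate.rotate
  · exact ((testBit_enc_bitPos h).1 (ha _ h')).rotate

lemma pack_mem {P : PreRotSys (Fin 7)} (hP : AllTwisted P) {w : Fin 5 → Fin 7}
    (hw : Function.Injective w) (χ : Fin 5 × Fin 5 × Fin 5 × Fin 5 → Bool)
    (hχ : ∀ t, χ t ↔ Ord P (w t.1) (w t.2.1) (w t.2.2.1) (w t.2.2.2)) :
    pack χ slots ∈ twistedPatterns := by
  obtain ⟨g, hg⟩ := hP w hw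
  obtain ⟨o, ho⟩ := t5_iff hg
  have hne : ∀ {i j : Fin 5}, i ≠ j → g.symm i ≠ g.symm j := fun h h' => h (g.symm.injective h')
  have hmem := pack_t5_mem o (g.symm 0) (g.symm 1) (hne (by decide)) (g.symm 2) (hne (by decide))
    (hne (by decide)) (g.symm 3) (hne (by decide)) (hne (by decide)) (hne (by decide))
    (g.symm 4) (hne (by decide)) (hne (by decide)) (hne (by decide)) (hne (by decide))
  have hvec : ![g.symm 0, g.symm 1, g.symm 2, g.symm 3, g.symm 4] = g.symm := by
    ext i; fin_cases i <;> rfl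
  rw [hvec] at hmem
  have nodup : ∀ t ∈ slots, [t.1, t.2.1, t.2.2.1, t.2.2.2].Nodup := by
    decide +kernel
  have congr : ∀ l : List (Fin 5 × Fin 5 × Fin 5 × Fin 5), (∀ t ∈ l, t ∈ slots) →
      pack χ l = pack (fun t => t5 o (g.symm t.1) (g.symm t.2.1) (g.symm t.2.2.1)
        (g.symm t.2.2.2)) l := by
    intro l hl
    induction l with
    | nil => rfl
    | cons t l ih =>
      have ht : χ t = t5 o (g.symm t.1) (g.symm t.2.1) (g.symm t.2.2.1) (g.symm t.2.2.2) := by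
        rw [Bool.eq_iff_iff, hχ, ← ho]
        · simp
        · have := nodup t (hl t (by simp))
          exact this.map g.symm.injective
      rw [pack, pack, ih fun t h => hl t (by simp [h]), ht]
  rw [congr slots fun _ h => h]
  exact hmem

lemma land_mem_table {P : PreRotSys (Fin 7)} (hP : AllTwisted P) {w : Fin 5 → Fin 7}
    (hw : StrictMono w) :
    Nat.land (enc P) (union (places w)) ∈ twistedPatterns.map (expand (places w)) := by
  classical
  let χ : Fin 5 × Fin 5 × Fin 5 × Fin 5 → Bool := fun t =>
    decide (Ord P (w t.1) (w t.2.1) (w t.2.2.1) (w t.2.2.2))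
  refine List.mem_map.2 ⟨pack χ slots, pack_mem hP hw.injective χ (by simp [χ]), Eq.symm ?_⟩
  apply Nat.eq_of_testBit_eq
  intro i
  rw [Bool.eq_iff_iff, places, testBit_expand]
  change ((enc P) &&& _).testBit i ↔ _
  rw [Nat.testBit_land, Bool.and_eq_true, testBit_union]
  simp only [List.mem_map, exists_exists_and_eq_and, Nat.testBit_two_pow, decide_eq_true_eq]
  have min : ∀ t ∈ slots, t.2.1 < t.2.2.1 ∧ t.2.1 < t.2.2.2 ∧ t.2.2.1 ≠ t.2.2.2 ∧
      t.1 ≠ t.2.1 ∧ t.1 ≠ t.2.2.1 ∧ t.1 ≠ t.2.2.2 := by decide +kernel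
  have min' : ∀ t ∈ slots, isMinFirst (w t.1) (w t.2.1) (w t.2.2.1) (w t.2.2.2) := by
    intro t ht
    obtain ⟨h1, h2, h3, h4, h5, h6⟩ := min t ht
    simp only [isMinFirst_iff, Fin.val_fin_lt, hw.lt_iff_lt, ne_eq, Fin.val_inj, hw.injective.eq_iff]
    exact ⟨h1, h2, h3, h4, h5, h6⟩
  constructor
  · rintro ⟨h, t, ht, rfl⟩
    exact ⟨t, ht, by simpa [χ] using (testBit_enc_bitPos (min' t ht)).1 h, rfl⟩
  · rintro ⟨t, ht, h, rfl⟩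
    exact ⟨(testBit_enc_bitPos (min' t ht)).2 (by simpa [χ] using h), t, ht, rfl⟩

lemma exists_iso_of_checkIso {P : PreRotSys (Fin 7)} {a c : ℕ} {l : List ℕ}
    (ha : Contained a (enc P)) (h : checkIso a c l) :
    ∃ P', IsoPRS P P' ∧ ∀ i ∈ l, Holds P' i := by
  rw [checkIso, Bool.and_eq_true] at h
  obtain ⟨h1, h2⟩ := h
  simp only [List.all_eq_true, List.mem_range] at h1 h2
  have ne : ∀ x y : Fin 7, y < x → dig c x ≠ dig c y := by
    intro x y hxy h
    have := h1 x x.2 y hxy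
    rw [Fin.ext_iff] at h
    simp [dig] at h
    simp [h] at this
  have inj : Function.Injective fun x : Fin 7 => dig c x := by
    intro x y h
    rcases lt_trichotomy x y with hxy | hxy | hxy
    exacts [(ne _ _ hxy h.symm).elim, hxy, (ne _ _ hxy h).elim]
  let e : Equiv.Perm (Fin 7) := Equiv.ofBijective _ inj.bijective_of_finite
  refine ⟨pullback P e (!Nat.beq (digit c 7) 0), isoPRS_pullback .., fun i hi => ?_⟩
  have := h2 i hi
  rw [Holds, ord_pullback]
  cases hr : Nat.beq (digit c 7) 0
  · rw [hr] at this
    exact ord_of_hasOrd (v := dig c (digit i 0)) (b := dig c (digit i 1))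
      (c := dig c (digit i 3)) (d := dig c (digit i 2)) ha this
  · rw [hr] at this
    exact ord_of_hasOrd (v := dig c (digit i 0)) (b := dig c (digit i 1))
      (c := dig c (digit i 2)) (d := dig c (digit i 3)) ha this

lemma exists_iso_of_classify {ws : List (Fin 5 → Fin 7)} {bases targets : List (List ℕ)}
    {certs : List ℕ} (h : classify ws bases targets certs = true) (hws : ∀ w ∈ ws, StrictMono w)
    {P : PreRotSys (Fin 7)} (hP : AllTwisted P) {l : List ℕ} (hl : l ∈ bases)
    (hPl : ∀ i ∈ l, Holds P i) :
    ∃ l' ∈ targets, ∃ P', IsoPRS P P' ∧ ∀ i ∈ l', Holds P' i := by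
  rw [classify, tablesK_eq, mapK_eq] at h
  obtain ⟨s', h⟩ := Option.isSome_iff_exists.1 h
  obtain ⟨s₁, s₂, h⟩ := foldOpt_mem h (t := union (l.map bitOf))
    (by simpa using ⟨l, hl, rfl⟩)
  rw [restrictK_eq] at h
  have hcont : Contained (union (l.map bitOf)) (enc P) := by
    intro i hi
    rw [testBit_union] at hi
    obtain ⟨x, hx, hi⟩ := hi
    obtain ⟨j, hj, rfl⟩ := List.mem_map.1 hx
    rw [bitOf] at hi
    split at hi
    · next hm =>
      rw [Nat.testBit_two_pow, decide_eq_true_eq] at hi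
      rw [← hi]
      exact (testBit_enc_bitPos (v := dig j 0) (b := dig j 1) (c := dig j 2) (d := dig j 3) hm).2
        (hPl j hj)
    · simp at hi
  have htab : List.Forall₂ (fun M T => Nat.land (enc P) M ∈ T)
      (ws.map fun w => union (places w))
      (ws.map fun w => twistedPatterns.map (expand (places w))) := by
    rw [List.forall₂_map_left_iff, List.forall₂_map_right_iff, List.forall₂_same]
    exact fun w hw => land_mem_table hP (hws w hw)
  obtain ⟨a, s, s', ha, hs⟩ := search_sound (restrict_sound hcont htab) hcont h
  cases s with
  | nil => simp [leafCheck] at hs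
  | cons c cs =>
    rw [leafCheck] at hs
    split at hs
    · simp at hs
    · next l' hl' =>
      split at hs
      · next hc => exact ⟨l', List.mem_of_getElem? hl', exists_iso_of_checkIso ha hc⟩
      · simp at hs

end Soundness

lemma classify_six : classify fiveSubsetsSix [fiveBase] sixTypes sixCerts = true := by
  decide +kernel

lemma classify_seven :
    classify fiveSubsetsSeven sixTypes ((List.range 9).map repTargets) sevenCerts = true := by
  decide +kernel

section Normalization

lemma dig_code (v b c d : Fin 7) : dig (code v b c d) 0 = v ∧ dig (code v b c d) 1 = b ∧
    dig (code v b c d) 2 = c ∧ dig (code v b c d) 3 = d := by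
  simp only [Fin.ext_iff, dig, digit, code]
  omega

lemma holds_code {P : PreRotSys (Fin 7)} {v b c d : Fin 7} :
    Holds P (code v b c d) ↔ Ord P v b c d := by
  obtain ⟨h0, h1, h2, h3⟩ := dig_code v b c d
  rw [Holds, h0, h1, h2, h3]

lemma exists_iso_fiveBase {P : PreRotSys (Fin 7)} (hP : AllTwisted P) :
    ∃ P', IsoPRS P P' ∧ ∀ i ∈ fiveBase, Holds P' i := by
  let ι : Fin 5 ↪ Fin 7 := Fin.castLEEmb (by norm_num)
  obtain ⟨e, he⟩ := hP ι ι.injective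
  obtain ⟨o, ho⟩ := t5_iff he
  refine ⟨pullback P (e.viaEmbedding ι) (!o), isoPRS_pullback .., fun i hi => ?_⟩
  obtain ⟨t, ht, rfl⟩ := List.mem_map.1 hi
  obtain ⟨hts, ht⟩ := List.mem_filter.1 ht
  have nodup : ∀ t ∈ slots, [t.1, t.2.1, t.2.2.1, t.2.2.2].Nodup ∧
      [t.1, t.2.1, t.2.2.2, t.2.2.1].Nodup := by
    decide +kernel
  have key : ∀ x : Fin 5, e.viaEmbedding ι (ι x) = ι (e x) := e.viaEmbedding_apply ι
  refine (holds_code (v := ι t.1) (b := ι t.2.1) (c := ι t.2.2.1) (d := ι t.2.2.2)).2 ?_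
  rw [ord_pullback]
  simp only [key]
  cases o
  · exact (ho _ _ _ _ (nodup t hts).2).2 ht
  · exact (ho _ _ _ _ (nodup t hts).1).2 ht

lemma strictMono_of_mem_fiveSubsetsSix : ∀ w ∈ fiveSubsetsSix, StrictMono w := by
  have key : fiveSubsetsSix.all fun w => decide (∀ i j, i < j → w i < w j) := by decide +kernel
  intro w hw i j
  exact of_decide_eq_true (List.all_eq_true.1 key w hw) i j

lemma strictMono_of_mem_fiveSubsetsSeven : ∀ w ∈ fiveSubsetsSeven, StrictMono w := by
  have key : fiveSubsetsSeven.all fun w => decide (∀ i j, i < j → w i < w j) := by decide +kernel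
  intro w hw i j
  exact of_decide_eq_true (List.all_eq_true.1 key w hw) i j

lemma exists_iso_repTargets {P : PreRotSys (Fin 7)} (hP : AllTwisted P) :
    ∃ (k : Fin 9) (P' : PreRotSys (Fin 7)), IsoPRS P P' ∧ ∀ i ∈ repTargets k, Holds P' i := by
  obtain ⟨P₁, h₁, hP₁⟩ := exists_iso_fiveBase hP
  have hP := allTwisted_of_iso h₁ hP
  obtain ⟨l, hl, P₂, h₂, hP₂⟩ := exists_iso_of_classify classify_six
    strictMono_of_mem_fiveSubsetsSix hP (List.mem_singleton_self fiveBase) hP₁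
  have hP := allTwisted_of_iso h₂ hP
  obtain ⟨l', hl', P₃, h₃, hP₃⟩ := exists_iso_of_classify classify_seven
    strictMono_of_mem_fiveSubsetsSeven hP hl hP₂
  obtain ⟨k, hk, rfl⟩ := List.mem_map.1 hl'
  exact ⟨⟨k, List.mem_range.1 hk⟩, P₃, isoPRS_trans (isoPRS_trans h₁ h₂) h₃, hP₃⟩

end Normalization

section Representatives

/-- The neighbour of `v` that comes `m` places after `x` in the `k`-th representative. -/
def repStep (k : Fin 9) (v : Fin 7) (m : ℕ) (x : Fin 7) : Fin 7 :=
  if x = v then v else repSeq k v ((repPos k v x + m) % 6)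

/-- The rotation at `v` in the `k`-th representative. -/
def repPerm (k : Fin 9) (v : Fin 7) : Equiv.Perm (Fin 7) where
  toFun := repStep k v 1
  invFun := repStep k v 5
  left_inv := by revert k v; unfold Function.LeftInverse; decide +kernel
  right_inv := by
    revert k v; unfold Function.RightInverse Function.LeftInverse; decide +kernel

lemma repSeq_repPos : ∀ (k : Fin 9) (v x : Fin 7), x ≠ v →
    repPos k v x < 6 ∧ repSeq k v (repPos k v x) = x := by
  decide +kernel

lemma repPos_repSeq : ∀ (k : Fin 9) (v : Fin 7) (i : Fin 6),
    repSeq k v i ≠ v ∧ repPos k v (repSeq k v i) = i := by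
  decide +kernel

lemma repPerm_apply_repSeq (k : Fin 9) (v : Fin 7) {i : ℕ} (hi : i < 6) :
    repPerm k v (repSeq k v i) = repSeq k v ((i + 1) % 6) := by
  obtain ⟨h1, h2⟩ := repPos_repSeq k v ⟨i, hi⟩
  change repStep k v 1 _ = _
  rw [repStep, if_neg h1, h2]

lemma repPerm_iterate (k : Fin 9) {v x : Fin 7} (hx : x ≠ v) (m : ℕ) :
    (repPerm k v)^[m] x = repSeq k v ((repPos k v x + m) % 6) := by
  obtain ⟨h1, h2⟩ := repSeq_repPos k v x hx
  induction m with
  | zero => rw [Nat.add_zero, Nat.mod_eq_of_lt h1, h2]; rfl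
  | succ m ih =>
    rw [Function.iterate_succ_apply', ih, repPerm_apply_repSeq k v (Nat.mod_lt _ (by norm_num)),
      Nat.mod_add_mod, Nat.add_assoc]

/-- The `k`-th representative. -/
def rep (k : Fin 9) : PreRotSys (Fin 7) where
  rot := repPerm k
  cyc v := by
    refine ⟨fun a ha => ?_, fun a ha b hb => ?_⟩
    · obtain rfl : a = v := by simpa using ha
      exact if_pos rfl
    · have ha : a ≠ v := by simpa using ha
      have hb : b ≠ v := by simpa using hb
      obtain ⟨h1, -⟩ := repSeq_repPos k v a ha
      obtain ⟨h2, h3⟩ := repSeq_repPos k v b hb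
      refine ⟨repPos k v b + 6 - repPos k v a, ?_⟩
      rw [repPerm_iterate k ha, Nat.add_sub_cancel' (by omega), Nat.add_mod_right,
        Nat.mod_eq_of_lt h2, h3]

/-- A decision procedure for `Ord` on the representatives. -/
def repOrd (k : Fin 9) (v b c d : Fin 7) : Bool :=
  !Nat.beq b v && !Nat.beq c v && !Nat.beq d v &&
    Nat.blt 0 ((repPos k v c + 6 - repPos k v b) % 6) &&
    Nat.blt ((repPos k v c + 6 - repPos k v b) % 6) ((repPos k v d + 6 - repPos k v b) % 6)

lemma ord_rep {k : Fin 9} {v b c d : Fin 7} : Ord (rep k) v b c d ↔ repOrd k v b c d := by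
  have pos : ∀ i, repSeq k v (i % 6) ≠ v ∧ repPos k v (repSeq k v (i % 6)) = i % 6 :=
    fun i => repPos_repSeq k v ⟨i % 6, Nat.mod_lt _ (by norm_num)⟩
  simp only [repOrd, Bool.and_eq_true, Nat.blt_eq, Bool.not_eq_true', ← Bool.not_eq_true,
    Nat.beq_eq, Fin.val_inj]
  constructor
  · rintro ⟨hb, i, j, hi, hij, hj, rfl, rfl⟩
    have hj : j < 6 := by simpa [Finset.card_erase_of_mem] using hj
    obtain ⟨h1, -⟩ := repSeq_repPos k v b hb
    change ((((b ≠ v ∧ (repPerm k v)^[i] b ≠ v) ∧ (repPerm k v)^[j] b ≠ v) ∧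
      0 < (repPos k v ((repPerm k v)^[i] b) + 6 - repPos k v b) % 6) ∧
      (repPos k v ((repPerm k v)^[i] b) + 6 - repPos k v b) % 6 <
        (repPos k v ((repPerm k v)^[j] b) + 6 - repPos k v b) % 6)
    rw [repPerm_iterate k hb, repPerm_iterate k hb, (pos _).2, (pos _).2]
    exact ⟨⟨⟨⟨hb, (pos _).1⟩, (pos _).1⟩, by omega⟩, by omega⟩
  · rintro ⟨⟨⟨⟨hb, hc⟩, hd⟩, h0⟩, h1⟩
    have := (repSeq_repPos k v b hb).1
    obtain ⟨hc1, hc2⟩ := repSeq_repPos k v c hc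
    obtain ⟨hd1, hd2⟩ := repSeq_repPos k v d hd
    refine ⟨hb, _, _, h0, h1, ?_, ?_, ?_⟩
    · simpa [Finset.card_erase_of_mem] using Nat.mod_lt _ (by norm_num)
    · refine (repPerm_iterate k hb _).trans ?_
      rw [← hc2]
      congr 1
      rw [hc2]
      omega
    · refine (repPerm_iterate k hb _).trans ?_
      rw [← hd2]
      congr 1
      rw [hd2]
      omega

lemma isoPRS_rep {P : PreRotSys (Fin 7)} {k : Fin 9} (h : ∀ i ∈ repTargets k, Holds P i) :
    IsoPRS P (rep k) := by
  refine ⟨1, Or.inl fun v => ?_⟩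
  have hS : (Finset.univ.erase v).card = 6 := by simp [Finset.card_erase_of_mem]
  have h0 : repSeq k v 0 ∈ Finset.univ.erase v := by simpa using (repPos_repSeq k v 0).1
  have key := iterate_eq_of_cycOrd (P.cyc v) hS (q := repSeq k v) h0 fun i hi =>
    (holds_code.1 (h _ (List.mem_flatMap.2
      ⟨v, List.mem_range.2 v.2, List.mem_map.2 ⟨i, hi, rfl⟩⟩))).2
  simp only [Equiv.Perm.coe_one, id_eq, one_mul, inv_one, mul_one]
  ext1 x
  by_cases hx : x = v
  · rw [(P.cyc v).1 x (by simp [hx])]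
    exact if_pos hx |>.trans hx.symm
  · obtain ⟨h1, h2⟩ := repSeq_repPos k v x hx
    rw [← h2]
    refine (repPerm_apply_repSeq k v h1).trans ?_
    rw [← key _ h1, ← Function.iterate_succ_apply' (P.rot v)]
    rcases Nat.lt_or_ge (repPos k v x + 1) 6 with h | h
    · rw [key _ h, Nat.mod_eq_of_lt h]
    · have : repPos k v x + 1 = (Finset.univ.erase v).card := by omega
      rw [Nat.succ_eq_add_one, this, iterate_card (P.cyc v) h0, hS]
end Representatives

section RepresentativesTwisted

/-- A decision procedure for `Crosses` on the representatives. -/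
def repCrosses (k : Fin 9) (p q r s : Fin 7) : Bool :=
  (repOrd k p q r s && repOrd k q p r s && repOrd k r p q s && repOrd k s p q r) ||
  (repOrd k p q s r && repOrd k q p s r && repOrd k r p s q && repOrd k s p r q)

lemma crosses_rep {k : Fin 9} {p q r s : Fin 7} :
    Crosses (rep k) p q r s ↔ repCrosses k p q r s := by
  simp only [crosses_iff_ord, ord_rep, repCrosses, Bool.or_eq_true, Bool.and_eq_true, and_assoc]

/-- The tuple encoded by a member of `repTwistedCodes`. -/
def repTuple (c : ℕ) (x : Fin 5) : Fin 7 := Fin.ofNat 7 (digit c x)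

lemma crosses_repTuple : ∀ k : Fin 9, ∀ c ∈ repTwistedCodes.getD k [], ∀ a b : Fin 5, a < b →
    ∀ c', b < c' → ∀ d, c' < d →
      repCrosses k (repTuple c a) (repTuple c b) (repTuple c d) (repTuple c c') := by
  decide +kernel

lemma exists_repTuple_avoiding : ∀ (k : Fin 9) (x y : Fin 7), x ≠ y →
    ∃ c ∈ repTwistedCodes.getD k [], (∀ a, repTuple c a ≠ x ∧ repTuple c a ≠ y) ∧
      ∀ a b, repTuple c a = repTuple c b → a = b := by
  decide +kernel

variable {α : Type*} [Fintype α] [DecidableEq α] {P : PreRotSys α}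

lemma not_crosses_of_crosses {a b c d : α} (h : Crosses P a b d c) :
    ¬ Crosses P a c b d ∧ ¬ Crosses P a b c d := by
  simp only [crosses_iff_ord] at *
  have r : ∀ {v b c d}, Ord P v b c d → Ord P v c d b := fun h => h.rotate
  have n : ∀ {v b c d}, Ord P v b c d → Ord P v b d c → False := fun h h' => h.asymm h'
  constructor <;> grind only

lemma allTwisted_rep (k : Fin 9) : AllTwisted (rep k) := by
  intro w hw
  obtain ⟨x, y, hxy, hc⟩ := Finset.card_eq_two.1
    (show (Finset.univ.image w)ᶜ.card = 2 by
      rw [Finset.card_compl, Finset.card_image_of_injective _ hw]; rfl)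
  obtain ⟨c, hck, hav, hinj⟩ := exists_repTuple_avoiding k x y hxy
  have hmem : ∀ a, ∃ i, w i = repTuple c a := by
    intro a
    have : repTuple c a ∉ (Finset.univ.image w)ᶜ := by
      rw [hc]
      simpa using hav a
    simpa using this
  choose e he using hmem
  have he_inj : Function.Injective e := fun a b h => hinj a b (by rw [← he, ← he, h])
  refine ⟨Equiv.ofBijective e he_inj.bijective_of_finite, fun a b c' d hab hbc hcd => ?_⟩
  simp only [Equiv.ofBijective_apply, he]
  have h := crosses_rep.2 (crosses_repTuple k c hck a b hab c' hbc d hcd)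
  exact ⟨h, not_crosses_of_crosses h⟩

lemma pi4Free_of_allTwisted {P : PreRotSys (Fin 7)} (hP : AllTwisted P) : Pi4Free P := by
  intro a b c d hab hac had hbc hbd hcd
  obtain ⟨x, hx⟩ : ∃ x, x ∉ ({a, b, c, d} : Finset (Fin 7)) := by
    by_contra! h
    have := Finset.card_le_card (Finset.subset_iff.2 fun x (_ : x ∈ Finset.univ) => h x)
    have h4 := Finset.card_le_four (a := a) (b := b) (c := c) (d := d)
    rw [Finset.card_univ, Fintype.card_fin] at this
    omega
  simp only [Finset.mem_insert, Finset.mem_singleton, not_or] at hx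
  obtain ⟨hxa, hxb, hxc, hxd⟩ := hx
  let w : Fin 5 → Fin 7 := ![a, b, c, d, x]
  have hw : Function.Injective w := by
    rw [← List.nodup_ofFn]
    simp [w, *, Ne.symm]
  obtain ⟨e, he⟩ := hP w hw
  obtain ⟨o, ho⟩ := t5_iff he
  have key : ∀ o : Bool, ∀ a b c d : Fin 5, [a, b, c, d].Nodup →
      ¬ (t5 o a b c d ∧ t5 o b a c d ∧ t5 o c a b d ∧ t5 o d a c b) ∧
      ¬ (t5 o a b d c ∧ t5 o b a d c ∧ t5 o c a d b ∧ t5 o d a b c) := by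
    decide +kernel
  have nodup : ∀ i j k l : Fin 5, [i, j, k, l].Nodup →
      [e.symm i, e.symm j, e.symm k, e.symm l].Nodup := fun i j k l h => h.map e.symm.injective
  have ord : ∀ i j k l : Fin 5, [i, j, k, l].Nodup → (rotOrd P (w i) (w j) (w k) (w l) ↔
      t5 o (e.symm i) (e.symm j) (e.symm k) (e.symm l)) := by
    intro i j k l h
    have hne : w j ≠ w i := fun h' => by
      rw [hw h'] at h
      simp at h
    rw [← ho _ _ _ _ (nodup i j k l h)]
    simp [Ord, hne]
  have := key o (e.symm 0) (e.symm 1) (e.symm 2) (e.symm 3) (nodup 0 1 2 3 (by decide))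
  rw [← ord 0 1 2 3 (by decide), ← ord 1 0 2 3 (by decide), ← ord 2 0 1 3 (by decide),
    ← ord 3 0 2 1 (by decide), ← ord 0 1 3 2 (by decide), ← ord 1 0 3 2 (by decide),
    ← ord 2 0 3 1 (by decide), ← ord 3 0 1 2 (by decide)] at this
  exact this

lemma genTwisted_rep (k : Fin 9) : GenTwisted (rep k) :=
  ⟨pi4Free_of_allTwisted (allTwisted_rep k), allTwisted_rep k⟩

end RepresentativesTwisted

section Invariant

open Classical in
/-- An invariant of isomorphism. -/
noncomputable def crossingSum (P : PreRotSys (Fin 7)) : ℕ :=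
  ∑ p, (∑ r, (∑ q, ∑ s, if Crosses P p q r s then 1 else 0) ^ 2) ^ 2

open Classical in
lemma crossingSum_eq_of_iso {P P' : PreRotSys (Fin 7)} (h : IsoPRS P P') :
    crossingSum P = crossingSum P' := by
  obtain ⟨e, he⟩ := isoPRS_crosses h
  unfold crossingSum
  refine (Fintype.sum_equiv e _ _ fun p => ?_)
  refine congrArg (· ^ 2) (Fintype.sum_equiv e _ _ fun r => ?_)
  refine congrArg (· ^ 2) (Fintype.sum_equiv e _ _ fun q => ?_)
  exact Fintype.sum_equiv e _ _ fun s => if_congr (he p q r s).symm rfl rfl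

lemma crossingSum_rep (k : Fin 9) : crossingSum (rep k) =
    ![1233536, 1249664, 1248128, 1261568, 1278080, 1290880, 1266176, 1276544, 1262848] k := by
  simp only [crossingSum, crosses_rep]
  have key : ∀ k : Fin 9, ∑ p, (∑ r, (∑ q, ∑ s, (repCrosses k p q r s).toNat) ^ 2) ^ 2 =
      ![1233536, 1249664, 1248128, 1261568, 1278080, 1290880, 1266176, 1276544, 1262848] k := by
    decide +kernel
  rw [← key]
  simp [Bool.toNat, Bool.cond_eq_ite]

lemma crossingSum_rep_injective : Function.Injective fun k => crossingSum (rep k) := by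
  have key : Function.Injective
      ![1233536, 1249664, 1248128, 1261568, 1278080, 1290880, 1266176, 1276544, 1262848] := by
    decide
  simpa only [crossingSum_rep] using key

end Invariant

end SevenTwisted

/-- Up to isomorphism (relabelling, possibly followed by reflection),
there are exactly 9 generalized twisted pre-rotation systems on a 7-element set. -/
theorem gen_twisted_on_seven_elements_up_to_iso :
    Nat.card (Quot (fun P P' : {Q : PreRotSys (Fin 7) // GenTwisted Q} =>
      IsoPRS P.1 P'.1)) = 9 := by
  let S := {Q : PreRotSys (Fin 7) // GenTwisted Q}
  let r : S → S → Prop := fun P P' => IsoPRS P.1 P'.1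
  let f : Fin 9 → Quot r :=
    fun k => Quot.mk r ⟨SevenTwisted.rep k, SevenTwisted.genTwisted_rep k⟩
  have hf : Function.Bijective f := by
    refine ⟨fun k k' h => ?_, fun q => ?_⟩
    · have := congrArg (Quot.lift (fun P : S => SevenTwisted.crossingSum P.1)
        fun _ _ => SevenTwisted.crossingSum_eq_of_iso) h
      exact SevenTwisted.crossingSum_rep_injective this
    · obtain ⟨P, rfl⟩ := Quot.exists_rep q
      obtain ⟨k, P', h, h'⟩ := SevenTwisted.exists_iso_repTargets P.2.2
      have hP : r P ⟨SevenTwisted.rep k, SevenTwisted.genTwisted_rep k⟩ :=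
        SevenTwisted.isoPRS_trans h (SevenTwisted.isoPRS_rep h')
      exact ⟨k, (Quot.sound hP).symm⟩
  exact (Nat.card_congr (Equiv.ofBijective f hf)).symm.trans (Nat.card_fin 9)
end
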